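/- arXiv:2212.08521 — 2 statements merged into one kernel-verified Lean document; each statement's English description precedes it below -/
import Mathlib

section
/- Let n ≥ 2. There exists a continuous map φ : 𝔻̄ → ℂⁿ from the closed unit disc such that φ(𝔻̄) is contained in the closed unit ball of ℂⁿ, φ maps the unit circle b𝔻 into the unit sphere {‖z‖ = 1}, and the restriction of φ to 𝔻 is a holomorphic immersion (φ'(ζ) ≠ 0 for every ζ ∈ 𝔻) with image contained in 𝔹ₙ, proper as a map from 𝔻 into 𝔹ₙ, and complete (for every divergent path γ : [0,1) → 𝔻 the path φ ∘ γ has infinite length). Moreover, if n ≥ 3 then φ|_𝔻 can in addition be chosen injective. -/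
open Set Metric
open scoped ENNReal

noncomputable section

/-- A path `γ : [0,1) → E` is a divergent path in the open set `Ω` if it is continuous on
`[0,1)`, takes values in `Ω`, and eventually leaves every compact subset of `Ω`. -/
def DivergentPathIn {E : Type*} [TopologicalSpace E] (Ω : Set E) (γ : ℝ → E) : Prop :=
  ContinuousOn γ (Set.Ico 0 1) ∧
  (∀ t ∈ Set.Ico (0 : ℝ) 1, γ t ∈ Ω) ∧
  ∀ K : Set E, K ⊆ Ω → IsCompact K →
    ∃ t₀ ∈ Set.Ico (0 : ℝ) 1, ∀ t ∈ Set.Ico t₀ 1, γ t ∉ K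

section Construction

open Filter Topology Polynomial

/-! ### Lengths of images of paths crossing an annulus -/

section Crossing

variable {E : Type*} [NormedAddCommGroup E]

/-- Every path in the disc of radius `b` that joins the disc of radius `a` to the circle of
radius `b` has an image under `φ` of length at least `c`. -/
def CrossingLength (φ : ℂ → E) (a b : ℝ) (c : ℝ≥0∞) : Prop :=
  ∀ (γ : ℝ → ℂ) (s t : ℝ), s ≤ t → ContinuousOn γ (Icc s t) → (∀ u ∈ Icc s t, ‖γ u‖ ≤ b) →
    ‖γ s‖ ≤ a → ‖γ t‖ = b → c ≤ eVariationOn (fun u => φ (γ u)) (Icc s t)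

lemma exists_first_hit {γ : ℝ → ℂ} {s t b : ℝ} (hst : s ≤ t) (hγ : ContinuousOn γ (Icc s t))
    (hs : ‖γ s‖ ≤ b) (ht : b ≤ ‖γ t‖) :
    ∃ u ∈ Icc s t, ‖γ u‖ = b ∧ ∀ v ∈ Icc s u, ‖γ v‖ ≤ b := by
  have hn : ContinuousOn (fun v => ‖γ v‖) (Icc s t) := hγ.norm
  have hcl : IsCompact (Icc s t ∩ (fun v => ‖γ v‖) ⁻¹' Ici b) :=
    isCompact_Icc.of_isClosed_subset (hn.preimage_isClosed_of_isClosed isClosed_Icc isClosed_Ici)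
      inter_subset_left
  obtain ⟨u, ⟨hu, hub⟩, hleast⟩ := hcl.exists_isLeast ⟨t, right_mem_Icc.2 hst, ht⟩
  have hlt : ∀ v ∈ Icc s t, v < u → ‖γ v‖ < b := fun v hv hvu => by
    by_contra! h
    exact absurd (hleast ⟨hv, h⟩) (not_le.2 hvu)
  have hsub : Icc s u ⊆ Icc s t := Icc_subset_Icc_right hu.2
  obtain ⟨w, hw, hwb⟩ := intermediate_value_Icc hu.1 (hn.mono hsub) ⟨hs, hub⟩
  have hwu : w = u := le_antisymm hw.2 (hleast ⟨hsub hw, hwb.ge⟩)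
  have hub' : ‖γ u‖ = b := hwu ▸ hwb
  refine ⟨u, hu, hub', fun v hv => ?_⟩
  rcases hv.2.eq_or_lt with rfl | h
  · exact hub'.le
  · exact (hlt v (hsub hv) h).le

lemma exists_last_hit {γ : ℝ → ℂ} {s t a : ℝ} (hst : s ≤ t) (hγ : ContinuousOn γ (Icc s t))
    (hs : ‖γ s‖ ≤ a) (ht : a ≤ ‖γ t‖) :
    ∃ u ∈ Icc s t, ‖γ u‖ = a ∧ ∀ v ∈ Icc u t, a ≤ ‖γ v‖ := by
  have hn : ContinuousOn (fun v => ‖γ v‖) (Icc s t) := hγ.norm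
  have hcl : IsCompact (Icc s t ∩ (fun v => ‖γ v‖) ⁻¹' Iic a) :=
    isCompact_Icc.of_isClosed_subset (hn.preimage_isClosed_of_isClosed isClosed_Icc isClosed_Iic)
      inter_subset_left
  obtain ⟨u, ⟨hu, hua⟩, hgreatest⟩ := hcl.exists_isGreatest ⟨s, left_mem_Icc.2 hst, hs⟩
  have hsub : Icc u t ⊆ Icc s t := Icc_subset_Icc_left hu.1
  obtain ⟨w, hw, hwa⟩ := intermediate_value_Icc hu.2 (hn.mono hsub) ⟨hua, ht⟩
  have hwu : w = u := le_antisymm (hgreatest ⟨hsub hw, hwa.le⟩) hw.1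
  have hua' : ‖γ u‖ = a := hwu ▸ hwa
  refine ⟨u, hu, hua', fun v hv => ?_⟩
  rcases hv.1.eq_or_lt with rfl | h
  · exact hua'.ge
  · by_contra! h'
    exact absurd (hgreatest ⟨hsub hv, h'.le⟩) (not_le.2 h)

lemma CrossingLength.trans {φ : ℂ → E} {a b d : ℝ} {c c' : ℝ≥0∞} (h : CrossingLength φ a b c)
    (h' : CrossingLength φ b d c') (hab : a ≤ b) (hbd : b ≤ d) :
    CrossingLength φ a d (c + c') := by
  intro γ s t hst hγ hd hs ht
  obtain ⟨u, hu, hub, hle⟩ := exists_first_hit hst hγ (hs.trans hab) (hbd.trans ht.ge)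
  have h1 := h γ s u hu.1 (hγ.mono (Icc_subset_Icc_right hu.2)) hle hs hub
  have h2 := h' γ u t hu.2 (hγ.mono (Icc_subset_Icc_left hu.1))
    (fun v hv => hd v (Icc_subset_Icc_left hu.1 hv)) hub.le ht
  have h3 := eVariationOn.Icc_add_Icc (fun v => φ (γ v)) hu.1 hu.2 (mem_univ u)
  simp only [univ_inter] at h3
  rw [← h3]
  exact add_le_add h1 h2

lemma CrossingLength.zero (φ : ℂ → E) (a b : ℝ) : CrossingLength φ a b 0 :=
  fun _ _ _ _ _ _ _ _ => zero_le

lemma CrossingLength.mono_length {φ : ℂ → E} {a b : ℝ} {c c' : ℝ≥0∞}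
    (h : CrossingLength φ a b c) (hc : c' ≤ c) : CrossingLength φ a b c' :=
  fun γ s t hst hγ hb hs ht => hc.trans (h γ s t hst hγ hb hs ht)

lemma CrossingLength.mono_left {φ : ℂ → E} {a a' b : ℝ} {c : ℝ≥0∞}
    (h : CrossingLength φ a b c) (ha : a' ≤ a) : CrossingLength φ a' b c :=
  fun γ s t hst hγ hb hs ht => h γ s t hst hγ hb (hs.trans ha) ht

/-- A map that expands small distances in an annulus by a factor `m` makes crossings long. -/
lemma crossingLength_of_expanding {φ : ℂ → E} {a b m δ : ℝ} (hm : 0 ≤ m) (hδ : 0 < δ)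
    (hab : a ≤ b)
    (h : ∀ z w, a ≤ ‖z‖ → ‖z‖ ≤ b → a ≤ ‖w‖ → ‖w‖ ≤ b → dist z w < δ →
      m * ‖z - w‖ ≤ ‖φ z - φ w‖) :
    CrossingLength φ a b (ENNReal.ofReal (m * (b - a))) := by
  intro γ s t hst hγ hb hs ht
  obtain ⟨s', hs', hsa, hge⟩ := exists_last_hit hst hγ hs (hab.trans ht.ge)
  have hsub : Icc s' t ⊆ Icc s t := Icc_subset_Icc_left hs'.1
  refine le_trans ?_ (eVariationOn.mono _ hsub)
  have huc : UniformContinuousOn γ (Icc s' t) :=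
    isCompact_Icc.uniformContinuousOn_of_continuous (hγ.mono hsub)
  obtain ⟨η, hη, hηγ⟩ := Metric.uniformContinuousOn_iff.1 huc δ hδ
  obtain ⟨N, hN⟩ := exists_nat_gt ((t - s') / η)
  have hst' : 0 ≤ t - s' := sub_nonneg.2 hs'.2
  have hN0 : (0 : ℝ) < N := lt_of_le_of_lt (by positivity) hN
  let p : ℕ → ℝ := fun i => s' + (t - s') * (i / N)
  have hp : Monotone p := fun i j hij => by
    simp only [p]
    gcongr
  have hpmem : ∀ i ≤ N, p i ∈ Icc s' t := fun i hi => by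
    have h1 : (i : ℝ) / N ≤ 1 := (div_le_one hN0).2 (by exact_mod_cast hi)
    have h0 : 0 ≤ (i : ℝ) / N := by positivity
    simp only [p, mem_Icc]
    constructor <;> nlinarith
  have hsum := eVariationOn.sum_le_of_monotoneOn_Icc (f := fun u => φ (γ u)) (s := Icc s' t)
    (m := 0) (n := N) (u := p) (hp.monotoneOn _) (fun i hi => hpmem i hi.2)
  refine le_trans ?_ hsum
  have hterm : ∀ i ∈ Finset.Ico 0 N, ENNReal.ofReal (m * (‖γ (p (i + 1))‖ - ‖γ (p i)‖)) ≤
      edist (φ (γ (p (i + 1)))) (φ (γ (p i))) := fun i hi => by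
    have hi' := (Finset.mem_Ico.1 hi).2
    have h1 := hpmem i hi'.le
    have h2 := hpmem (i + 1) hi'
    rw [edist_dist]
    apply ENNReal.ofReal_le_ofReal
    rw [dist_eq_norm]
    refine le_trans (mul_le_mul_of_nonneg_left (norm_sub_norm_le _ _) hm) ?_
    refine h _ _ (hge _ h2) (hb _ (hsub h2)) (hge _ h1) (hb _ (hsub h1)) ?_
    refine hηγ _ h2 _ h1 ?_
    rw [Real.dist_eq, abs_of_nonneg (sub_nonneg.2 (hp (Nat.le_succ i)))]
    have : p (i + 1) - p i = (t - s') / N := by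
      simp only [p]
      push_cast
      field_simp
      ring
    rw [this, div_lt_iff₀ hN0]
    rwa [div_lt_iff₀ hη, mul_comm] at hN
  have htel : ∑ i ∈ Finset.Ico 0 N, m * (‖γ (p (i + 1))‖ - ‖γ (p i)‖) = m * (b - a) := by
    rw [← Finset.mul_sum, Finset.sum_Ico_sub (fun i => ‖γ (p i)‖) (Nat.zero_le N)]
    have h0 : p 0 = s' := by simp [p]
    have h1 : p N = t := by simp [p, div_self hN0.ne']
    rw [h0, h1, ht, hsa]
  calc ENNReal.ofReal (m * (b - a))
      = ENNReal.ofReal (∑ i ∈ Finset.Ico 0 N, m * (‖γ (p (i + 1))‖ - ‖γ (p i)‖)) := by rw [htel]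
    _ ≤ ∑ i ∈ Finset.Ico 0 N, ENNReal.ofReal (m * (‖γ (p (i + 1))‖ - ‖γ (p i)‖)) := by
        induction Finset.Ico 0 N using Finset.induction_on with
        | empty => simp
        | insert i S hi ih =>
          rw [Finset.sum_insert hi, Finset.sum_insert hi]
          exact ENNReal.ofReal_add_le.trans (add_le_add le_rfl ih)
    _ ≤ _ := Finset.sum_le_sum hterm

/-- A map for which each of infinitely many consecutive annuli exhausting the disc has unit
crossing length is complete. -/
lemma eVariationOn_eq_top_of_crossingLength {φ : ℂ → E} {a : ℕ → ℝ} (ha : Monotone a)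
    (ha1 : ∀ k, a k < 1) (hlim : Tendsto a atTop (𝓝 1))
    (h : ∀ k, CrossingLength φ (a k) (a (k + 1)) 1) {γ : ℝ → ℂ}
    (hγ : DivergentPathIn (ball (0 : ℂ) 1) γ) :
    eVariationOn (fun t => φ (γ t)) (Ico 0 1) = ⊤ := by
  obtain ⟨hc, hmem, hdiv⟩ := hγ
  have h0 : ‖γ 0‖ < 1 := by simpa using hmem 0 (by simp)
  obtain ⟨k, hk⟩ := (hlim.eventually (lt_mem_nhds h0)).exists
  have hsum : ∀ m : ℕ, CrossingLength φ (a k) (a (k + m)) m := fun m => by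
    induction m with
    | zero => simpa using CrossingLength.zero φ _ _
    | succ m ih =>
      have := ih.trans (h (k + m)) (ha (Nat.le_add_right k m)) (ha (Nat.le_succ _))
      simpa [add_assoc] using this
  refine ENNReal.eq_top_of_forall_nnreal_le fun r => ?_
  obtain ⟨m, hm⟩ := exists_nat_ge r
  refine le_trans (by exact_mod_cast hm : (r : ℝ≥0∞) ≤ m) ?_
  obtain ⟨t, ht, htK⟩ := hdiv (closedBall 0 (a (k + m)))
    (closedBall_subset_ball (ha1 _)) (isCompact_closedBall _ _)
  have htm : a (k + m) ≤ ‖γ t‖ := by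
    have := htK t ⟨le_rfl, ht.2⟩
    rw [mem_closedBall_zero_iff, not_le] at this
    exact this.le
  have hsub : Icc 0 t ⊆ Ico (0 : ℝ) 1 := fun v hv => ⟨hv.1, hv.2.trans_lt ht.2⟩
  obtain ⟨u, hu, hub, hle⟩ := exists_first_hit ht.1 (hc.mono hsub)
    (hk.le.trans (ha (Nat.le_add_right k m))) htm
  have hsub' : Icc 0 u ⊆ Ico (0 : ℝ) 1 := (Icc_subset_Icc_right hu.2).trans hsub
  exact (hsum m γ 0 u hu.1 (hc.mono hsub') hle hk.le hub).trans (eVariationOn.mono _ hsub')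

end Crossing

/-! ### Perturbations that are small in the Lipschitz sense -/

section Lipschitz

variable {E : Type*} [NormedAddCommGroup E]

/-- The difference `φ - F` is `e`-Lipschitz on the closed disc of radius `b`. -/
def LipClose (e b : ℝ) (φ F : ℂ → E) : Prop :=
  ∀ z w, ‖z‖ ≤ b → ‖w‖ ≤ b → ‖(φ z - F z) - (φ w - F w)‖ ≤ e * ‖z - w‖

lemma LipClose.refl {e : ℝ} (he : 0 ≤ e) (b : ℝ) (F : ℂ → E) : LipClose e b F F :=
  fun z w _ _ => by
    simp only [sub_self, norm_zero]
    positivity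

lemma LipClose.trans {e e' b : ℝ} {φ F G : ℂ → E} (h : LipClose e b φ F)
    (h' : LipClose e' b F G) : LipClose (e + e') b φ G := fun z w hz hw => by
  have h1 := norm_add_le_of_le (h z w hz hw) (h' z w hz hw)
  rw [add_mul]
  refine le_trans (le_of_eq ?_) h1
  congr 1
  abel

lemma LipClose.mono {e e' b b' : ℝ} {φ F : ℂ → E} (h : LipClose e b φ F) (he : e ≤ e')
    (hb : b' ≤ b) : LipClose e' b' φ F := fun z w hz hw =>
  (h z w (hz.trans hb) (hw.trans hb)).trans (by gcongr)

/-- The lower bound `c` for the crossing length persists under small Lipschitz perturbations. -/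
def StablyCrosses (F : ℂ → E) (a b : ℝ) (c : ℝ≥0∞) : Prop :=
  ∃ e > 0, ∀ φ, LipClose e b φ F → CrossingLength φ a b c

lemma StablyCrosses.zero (F : ℂ → E) (a b : ℝ) : StablyCrosses F a b 0 :=
  ⟨1, one_pos, fun φ _ => CrossingLength.zero φ a b⟩

lemma StablyCrosses.trans {F : ℂ → E} {a b d : ℝ} {c c' : ℝ≥0∞} (h : StablyCrosses F a b c)
    (h' : StablyCrosses F b d c') (hab : a ≤ b) (hbd : b ≤ d) :
    StablyCrosses F a d (c + c') := by
  obtain ⟨e, he, hF⟩ := h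
  obtain ⟨e', he', hF'⟩ := h'
  exact ⟨min e e', lt_min he he', fun φ hφ =>
    (hF φ (hφ.mono (min_le_left _ _) hbd)).trans (hF' φ (hφ.mono (min_le_right _ _) le_rfl))
      hab hbd⟩

lemma StablyCrosses.mono_length {F : ℂ → E} {a b : ℝ} {c c' : ℝ≥0∞}
    (h : StablyCrosses F a b c) (hc : c' ≤ c) : StablyCrosses F a b c' := by
  obtain ⟨e, he, hF⟩ := h
  exact ⟨e, he, fun φ hφ => (hF φ hφ).mono_length hc⟩

lemma StablyCrosses.mono_left {F : ℂ → E} {a a' b : ℝ} {c : ℝ≥0∞}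
    (h : StablyCrosses F a b c) (ha : a' ≤ a) : StablyCrosses F a' b c := by
  obtain ⟨e, he, hF⟩ := h
  exact ⟨e, he, fun φ hφ => (hF φ hφ).mono_left ha⟩

lemma StablyCrosses.mono_right {F : ℂ → E} {a b b' : ℝ} {c : ℝ≥0∞}
    (h : StablyCrosses F a b c) (hab : a ≤ b) (hb : b ≤ b') : StablyCrosses F a b' c := by
  simpa using h.trans (StablyCrosses.zero F b b') hab hb

/-- Stable crossing lower bounds are inherited by all sufficiently close maps. -/
lemma StablyCrosses.exists_forall_lipClose {F : ℂ → E} {a b : ℝ} {c : ℝ≥0∞}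
    (h : StablyCrosses F a b c) :
    ∃ e > 0, ∀ G, LipClose e b G F → StablyCrosses G a b c := by
  obtain ⟨e, he, hF⟩ := h
  refine ⟨e / 2, half_pos he, fun G hG => ⟨e / 2, half_pos he, fun φ hφ => hF φ ?_⟩⟩
  simpa using hφ.trans hG

end Lipschitz

/-! ### Crossing estimates from derivatives -/

lemma exists_radius_half_le_norm {E : Type*} [NormedAddCommGroup E] {P : ℂ → E}
    (hP : Continuous P) {μ : ℝ} (hμ : 0 < μ) (h : ∀ z, ‖z‖ = 1 → μ ≤ ‖P z‖) :
    ∃ r < 1, ∀ z, r ≤ ‖z‖ → ‖z‖ ≤ 1 → μ / 2 ≤ ‖P z‖ := by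
  have huc := (isCompact_closedBall (0 : ℂ) 1).uniformContinuousOn_of_continuous hP.continuousOn
  obtain ⟨δ, hδ, hδP⟩ := Metric.uniformContinuousOn_iff.1 huc (μ / 2) (half_pos hμ)
  refine ⟨1 - min (δ / 2) (1 / 2), by linarith [lt_min (half_pos hδ) (by norm_num : (0:ℝ) < 1 / 2)],
    fun z hz hz1 => ?_⟩
  have hz0 : 0 < ‖z‖ := by linarith [min_le_right (δ / 2) (1 / 2)]
  have hzδ : 1 - ‖z‖ < δ := by linarith [min_le_left (δ / 2) (1 / 2)]
  have hw : ‖(‖z‖⁻¹ : ℝ) • z‖ = 1 := by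
    rw [norm_smul, norm_inv, norm_norm, inv_mul_cancel₀ hz0.ne']
  have hdist : dist ((‖z‖⁻¹ : ℝ) • z) z < δ := by
    have : (‖z‖⁻¹ : ℝ) • z - z = (‖z‖⁻¹ - 1 : ℝ) • z := by rw [sub_smul, one_smul]
    rw [dist_eq_norm, this, norm_smul, Real.norm_of_nonneg, sub_mul, inv_mul_cancel₀ hz0.ne',
      one_mul]
    · exact hzδ
    · rw [sub_nonneg]
      exact (one_le_inv₀ hz0).2 hz1
  have h1 := hδP _ (mem_closedBall_zero_iff.2 hw.le) z (mem_closedBall_zero_iff.2 hz1) hdist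
  rw [dist_eq_norm] at h1
  have h2 := h _ hw
  have h3 := norm_sub_norm_le (P ((‖z‖⁻¹ : ℝ) • z)) (P z)
  linarith

section Derivatives

variable {E : Type*} [NormedAddCommGroup E] [NormedSpace ℂ E]

lemma lipClose_of_norm_deriv_le {F G : ℂ → E} {e b : ℝ} (hF : Differentiable ℂ F)
    (hG : Differentiable ℂ G) (h : ∀ z, ‖z‖ ≤ b → ‖deriv (fun z => F z - G z) z‖ ≤ e) :
    LipClose e b F G := fun _ _ hz hw =>
  (convex_closedBall (0 : ℂ) b).norm_image_sub_le_of_norm_deriv_le (𝕜 := ℂ)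
    (f := fun z => F z - G z) (fun x _ => (hF x).sub (hG x))
    (fun x hx => h x (mem_closedBall_zero_iff.1 hx))
    (mem_closedBall_zero_iff.2 hw) (mem_closedBall_zero_iff.2 hz)

lemma stablyCrosses_of_le_norm_deriv {F : ℂ → E} (hF : ContDiff ℂ 1 F) {a b m : ℝ} (hm : 0 < m)
    (hab : a ≤ b) (h : ∀ z, a ≤ ‖z‖ → ‖z‖ ≤ b → m ≤ ‖deriv F z‖) :
    StablyCrosses F a b (ENNReal.ofReal (m / 4 * (b - a))) := by
  have hd : Differentiable ℂ F := hF.differentiable one_ne_zero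
  have hcont : Continuous (deriv F) := hF.continuous_deriv le_rfl
  have huc := (isCompact_closedBall (0 : ℂ) (b + 1)).uniformContinuousOn_of_continuous
    hcont.continuousOn
  obtain ⟨δ, hδ, hδF⟩ := Metric.uniformContinuousOn_iff.1 huc (m / 2) (half_pos hm)
  refine ⟨m / 4, by positivity, fun φ hφ => crossingLength_of_expanding (δ := min δ 1)
    (by positivity) (lt_min hδ one_pos) hab fun z w haz hzb haw hwb hzw => ?_⟩
  have hball : ∀ x ∈ ball z (min δ 1), ‖deriv (fun x => F x - x • deriv F z) x‖ ≤ m / 2 := by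
    intro x hx
    have hdx : deriv (fun x => F x - x • deriv F z) x = deriv F x - deriv F z := by
      have h1 : HasDerivAt (fun x : ℂ => x • deriv F z) ((1 : ℂ) • deriv F z) x :=
        (hasDerivAt_id x).smul_const _
      rw [one_smul] at h1
      exact ((hd x).hasDerivAt.sub h1).deriv
    rw [hdx, ← dist_eq_norm]
    have hxz : dist x z < min δ 1 := hx
    refine (hδF x ?_ z ?_ (hxz.trans_le (min_le_left _ _))).le
    · have h1 : ‖x - z‖ < 1 := by
        rw [← dist_eq_norm]
        exact hxz.trans_le (min_le_right _ _)
      have h2 := norm_le_norm_add_norm_sub' x z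
      rw [mem_closedBall_zero_iff]
      linarith
    · rw [mem_closedBall_zero_iff]
      linarith
  have hdiff : ∀ x ∈ ball z (min δ 1), DifferentiableAt ℂ (fun x => F x - x • deriv F z) x :=
    fun x _ => (hd x).sub (differentiableAt_id.smul_const _)
  have key := (convex_ball z (min δ 1)).norm_image_sub_le_of_norm_deriv_le (𝕜 := ℂ) hdiff hball
    (mem_ball.2 (by rwa [dist_comm])) (mem_ball_self (lt_min hδ one_pos)) (x := w) (y := z)
  have h1 := hφ z w hzb hwb
  have h2 : m * ‖z - w‖ ≤ ‖(z - w) • deriv F z‖ := by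
    rw [norm_smul, mul_comm]
    gcongr
    exact h z haz hzb
  have h3 : (z - w) • deriv F z = (φ z - φ w) - ((φ z - F z) - (φ w - F w)) -
      ((F z - z • deriv F z) - (F w - w • deriv F z)) := by
    rw [sub_smul]
    abel
  rw [h3] at h2
  have h4 := norm_sub_le ((φ z - φ w) - ((φ z - F z) - (φ w - F w)))
    ((F z - z • deriv F z) - (F w - w • deriv F z))
  have h5 := norm_sub_le (φ z - φ w) ((φ z - F z) - (φ w - F w))
  linarith

lemma hasDerivAt_pow_smul {P : ℂ → E} (hP : Differentiable ℂ P) (N : ℕ) (z : ℂ) :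
    HasDerivAt (fun z => z ^ N • P z)
      (z ^ N • deriv P z + ((N : ℂ) * z ^ (N - 1)) • P z) z :=
  (hasDerivAt_pow N z).smul (hP z).hasDerivAt

lemma eventually_lipClose_add_pow_smul {H P : ℂ → E} (hH : Differentiable ℂ H)
    (hP : ContDiff ℂ 1 P) {a η : ℝ} (ha : 0 ≤ a) (ha1 : a < 1) (hη : 0 < η) :
    ∀ᶠ N : ℕ in atTop, LipClose η a (fun z => H z + z ^ N • P z) H := by
  have hPd : Differentiable ℂ P := hP.differentiable one_ne_zero
  obtain ⟨C, hC⟩ := (isCompact_closedBall (0 : ℂ) a).exists_bound_of_continuousOn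
    hP.continuous.continuousOn
  obtain ⟨C', hC'⟩ := (isCompact_closedBall (0 : ℂ) a).exists_bound_of_continuousOn
    (hP.continuous_deriv le_rfl).continuousOn
  have h1 : Tendsto (fun N : ℕ => (N : ℝ) * a ^ (N - 1)) atTop (𝓝 0) := by
    rw [← tendsto_add_atTop_iff_nat 1]
    have h2 := tendsto_self_mul_const_pow_of_lt_one ha ha1
    have h3 := tendsto_pow_atTop_nhds_zero_of_lt_one ha ha1
    have h4 := h2.add h3
    simp only [add_zero] at h4
    refine h4.congr fun N => ?_
    push_cast
    ring
  have h2 := tendsto_pow_atTop_nhds_zero_of_lt_one ha ha1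
  have h3 : Tendsto (fun N : ℕ => a ^ N * C' + N * a ^ (N - 1) * C) atTop (𝓝 0) := by
    simpa using (h2.mul_const C').add (h1.mul_const C)
  filter_upwards [h3.eventually (gt_mem_nhds hη)] with N hN
  refine lipClose_of_norm_deriv_le (hH.add ((differentiable_id.pow N).smul hPd)) hH
    fun z hz => ?_
  have hza : z ∈ closedBall (0 : ℂ) a := mem_closedBall_zero_iff.2 hz
  simp only [add_sub_cancel_left]
  rw [(hasDerivAt_pow_smul hPd N z).deriv]
  refine (norm_add_le _ _).trans (le_trans ?_ hN.le)
  rw [norm_smul, norm_smul, norm_mul, norm_pow, norm_pow, Complex.norm_natCast]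
  gcongr
  · exact hC' z hza
  · exact hC z hza

/-- Adding `z ^ N • P z` with `P` bounded below on the circle makes crossings of a thin annulus
near the circle long. -/
lemma eventually_stablyCrosses_add_pow_smul {H P : ℂ → E} (hH : ContDiff ℂ 1 H)
    (hP : ContDiff ℂ 1 P) {a μ : ℝ} (ha1 : a < 1) (hμ : 0 < μ)
    (h : ∀ z, ‖z‖ = 1 → μ ≤ ‖P z‖) :
    ∀ᶠ N : ℕ in atTop, ∃ b, a < b ∧ b < 1 ∧
      StablyCrosses (fun z => H z + z ^ N • P z) a b (ENNReal.ofReal (μ / 128)) := by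
  have hPd : Differentiable ℂ P := hP.differentiable one_ne_zero
  have hHd : Differentiable ℂ H := hH.differentiable one_ne_zero
  obtain ⟨r, hr1, hr⟩ := exists_radius_half_le_norm hP.continuous hμ h
  obtain ⟨C, hC⟩ := (isCompact_closedBall (0 : ℂ) 1).exists_bound_of_continuousOn
    (hH.continuous_deriv le_rfl).continuousOn
  obtain ⟨C', hC'⟩ := (isCompact_closedBall (0 : ℂ) 1).exists_bound_of_continuousOn
    (hP.continuous_deriv le_rfl).continuousOn
  have hlim : Tendsto (fun N : ℕ => 1 - 1 / 2 * (1 / (N : ℝ))) atTop (𝓝 1) := by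
    have h1 := ((tendsto_one_div_atTop_nhds_zero_nat (𝕜 := ℝ)).const_mul (1 / 2)).const_sub 1
    rwa [mul_zero, sub_zero] at h1
  filter_upwards [hlim.eventually (lt_mem_nhds (max_lt hr1 ha1)), eventually_ge_atTop 1,
    tendsto_natCast_atTop_atTop.eventually_ge_atTop (8 * (C + C') / μ)] with N hN hN1 hNC
  have hN0 : (1 : ℝ) ≤ N := by exact_mod_cast hN1
  have hNpos : (0 : ℝ) < N := by linarith
  have hinv : 0 < 1 / (N : ℝ) := by positivity
  have hinv1 : 1 / (N : ℝ) ≤ 1 := (div_le_one hNpos).2 hN0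
  obtain ⟨hNr, hNa⟩ := max_lt_iff.1 hN
  refine ⟨1 - 1 / 4 * (1 / N), by linarith, by linarith, ?_⟩
  have hcross : StablyCrosses (fun z => H z + z ^ N • P z) (1 - 1 / 2 * (1 / N))
      (1 - 1 / 4 * (1 / N)) (ENNReal.ofReal (N * μ / 8 / 4 *
        ((1 - 1 / 4 * (1 / N)) - (1 - 1 / 2 * (1 / N))))) := by
    refine stablyCrosses_of_le_norm_deriv (hH.add ((contDiff_id.pow N).smul hP))
      (by positivity) (by linarith) fun z hz hz' => ?_
    have hz1 : ‖z‖ ≤ 1 := by linarith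
    have hzball : z ∈ closedBall (0 : ℂ) 1 := mem_closedBall_zero_iff.2 hz1
    have hzpow : 1 / 2 ≤ ‖z‖ ^ (N - 1) := by
      have h1 : 1 / 2 ≤ ‖z‖ ^ N := by
        have hb := one_add_mul_le_pow (a := ‖z‖ - 1) (by linarith) N
        have h2 : (N : ℝ) * (‖z‖ - 1) ≥ -(1 / 2) := by
          have h3 : (N : ℝ) * (-(1 / 2 * (1 / N))) ≤ N * (‖z‖ - 1) := by
            gcongr
            linarith
          have h4 : (N : ℝ) * (-(1 / 2 * (1 / N))) = -(1 / 2) := by field_simp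
          linarith
        have h5 : 1 + (‖z‖ - 1) = ‖z‖ := by ring
        rw [h5] at hb
        linarith
      exact h1.trans (pow_le_pow_of_le_one (norm_nonneg z) hz1 (Nat.sub_le N 1))
    have hderiv : deriv (fun z => H z + z ^ N • P z) z =
        deriv H z + (z ^ N • deriv P z + ((N : ℂ) * z ^ (N - 1)) • P z) :=
      ((hHd z).hasDerivAt.add (hasDerivAt_pow_smul hPd N z)).deriv
    have hmain : N * μ / 4 ≤ ‖((N : ℂ) * z ^ (N - 1)) • P z‖ := by
      rw [norm_smul, norm_mul, norm_pow, Complex.norm_natCast]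
      calc N * μ / 4 = N * (1 / 2) * (μ / 2) := by ring
        _ ≤ _ := by
          gcongr
          exact hr z (by linarith) hz1
    have hP' : ‖z ^ N • deriv P z‖ ≤ C' := by
      rw [norm_smul, norm_pow]
      calc ‖z‖ ^ N * ‖deriv P z‖ ≤ 1 * ‖deriv P z‖ := by
            gcongr
            exact pow_le_one₀ (norm_nonneg z) hz1
        _ ≤ C' := by simpa using hC' z hzball
    have hH' := hC z hzball
    change N * μ / 8 ≤ ‖deriv (fun z => H z + z ^ N • P z) z‖
    rw [hderiv]
    have h1 : ((N : ℂ) * z ^ (N - 1)) • P z =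
        (deriv H z + (z ^ N • deriv P z + ((N : ℂ) * z ^ (N - 1)) • P z)) - deriv H z -
          z ^ N • deriv P z := by abel
    rw [h1] at hmain
    have h2 := norm_sub_le ((deriv H z + (z ^ N • deriv P z + ((N : ℂ) * z ^ (N - 1)) • P z))
      - deriv H z) (z ^ N • deriv P z)
    have h3 := norm_sub_le (deriv H z + (z ^ N • deriv P z + ((N : ℂ) * z ^ (N - 1)) • P z))
      (deriv H z)
    rw [div_le_iff₀ hμ] at hNC
    linarith
  have hval : N * μ / 8 / 4 * ((1 - 1 / 4 * (1 / (N : ℝ))) - (1 - 1 / 2 * (1 / N))) =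
      μ / 128 := by
    field_simp
    ring
  rw [hval] at hcross
  exact hcross.mono_left hNa.le

/-- The maximum principle on the unit disc. -/
lemma norm_le_of_forall_norm_eq_one {F : ℂ → E} (hF : Differentiable ℂ F) {C : ℝ}
    (h : ∀ z, ‖z‖ = 1 → ‖F z‖ ≤ C) {z : ℂ} (hz : ‖z‖ ≤ 1) : ‖F z‖ ≤ C := by
  refine Complex.norm_le_of_forall_mem_frontier_norm_le (isBounded_ball (x := (0 : ℂ)) (r := 1))
    hF.diffContOnCl (fun w hw => h w ?_) ?_
  · rw [frontier_ball _ one_ne_zero] at hw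
    simpa using hw
  · rw [closure_ball _ one_ne_zero]
    simpa using hz

end Derivatives

/-! ### Polynomial maps into `ℂ²` -/

section PolynomialMaps

/-- Maps `ℂ → ℂ²` with polynomial components. -/
def IsPolyMap (F : ℂ → EuclideanSpace ℂ (Fin 2)) : Prop :=
  ∃ p q : ℂ[X], F = fun z => !₂[p.eval z, q.eval z]

lemma IsPolyMap.contDiff {F : ℂ → EuclideanSpace ℂ (Fin 2)} (hF : IsPolyMap F) {n : ℕ∞} :
    ContDiff ℂ n F := by
  obtain ⟨p, q, rfl⟩ := hF
  rw [contDiff_euclidean]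
  intro i
  fin_cases i
  · simpa using p.contDiff_aeval (𝕜 := ℂ) (n := n)
  · simpa using q.contDiff_aeval (𝕜 := ℂ) (n := n)

lemma IsPolyMap.differentiable {F : ℂ → EuclideanSpace ℂ (Fin 2)} (hF : IsPolyMap F) :
    Differentiable ℂ F := (hF.contDiff (n := 1)).differentiable one_ne_zero

lemma IsPolyMap.add {F G : ℂ → EuclideanSpace ℂ (Fin 2)} (hF : IsPolyMap F)
    (hG : IsPolyMap G) : IsPolyMap (fun z => F z + G z) := by
  obtain ⟨p, q, rfl⟩ := hF
  obtain ⟨p', q', rfl⟩ := hG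
  refine ⟨p + p', q + q', funext fun z => ?_⟩
  ext i
  fin_cases i <;> simp

lemma IsPolyMap.smul {F : ℂ → EuclideanSpace ℂ (Fin 2)} (hF : IsPolyMap F) (c : ℂ[X]) :
    IsPolyMap (fun z => c.eval z • F z) := by
  obtain ⟨p, q, rfl⟩ := hF
  refine ⟨c * p, c * q, funext fun z => ?_⟩
  ext i
  fin_cases i <;> simp

lemma IsPolyMap.pow_smul {F : ℂ → EuclideanSpace ℂ (Fin 2)} (hF : IsPolyMap F) (N : ℕ) :
    IsPolyMap (fun z => z ^ N • F z) := by
  simpa using hF.smul (X ^ N)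

lemma isPolyMap_const (v : EuclideanSpace ℂ (Fin 2)) : IsPolyMap fun _ => v := by
  refine ⟨C (v 0), C (v 1), funext fun z => ?_⟩
  ext i
  fin_cases i <;> simp

lemma isPolyMap_smul_const (v : EuclideanSpace ℂ (Fin 2)) : IsPolyMap fun z => z • v := by
  simpa using (isPolyMap_const v).smul X

/-- On the unit circle, the complex conjugate of a polynomial is a polynomial up to a power. -/
lemma exists_eval_eq_pow_mul_conj (p : ℂ[X]) :
    ∃ M₀ : ℕ, ∀ M ≥ M₀, ∃ q : ℂ[X], ∀ z : ℂ, ‖z‖ = 1 →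
      q.eval z = z ^ M * (starRingEnd ℂ) (p.eval z) := by
  induction p using Polynomial.induction_on' with
  | add p q hp hq =>
    obtain ⟨M₁, h₁⟩ := hp
    obtain ⟨M₂, h₂⟩ := hq
    refine ⟨max M₁ M₂, fun M hM => ?_⟩
    obtain ⟨p', hp'⟩ := h₁ M ((le_max_left _ _).trans hM)
    obtain ⟨q', hq'⟩ := h₂ M ((le_max_right _ _).trans hM)
    refine ⟨p' + q', fun z hz => ?_⟩
    rw [eval_add, eval_add, hp' z hz, hq' z hz, map_add, mul_add]
  | monomial n a =>
    refine ⟨n, fun M hM => ⟨monomial (M - n) ((starRingEnd ℂ) a), fun z hz => ?_⟩⟩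
    have h1 : z ^ n * (starRingEnd ℂ) z ^ n = 1 := by
      rw [← mul_pow, Complex.mul_conj, Complex.normSq_eq_norm_sq, hz]
      simp
    rw [eval_monomial, eval_monomial, map_mul, map_pow]
    calc (starRingEnd ℂ) a * z ^ (M - n)
        = (starRingEnd ℂ) a * z ^ (M - n) * (z ^ n * (starRingEnd ℂ) z ^ n) := by
          rw [h1, mul_one]
      _ = (starRingEnd ℂ) a * (z ^ (M - n) * z ^ n) * (starRingEnd ℂ) z ^ n := by ring
      _ = _ := by
          rw [← pow_add, Nat.sub_add_cancel hM]
          ring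

/-- Every polynomial map into `ℂ²` has a polynomial companion of the same norm that is
orthogonal to it along the circle. -/
lemma IsPolyMap.exists_orthogonal {F : ℂ → EuclideanSpace ℂ (Fin 2)} (hF : IsPolyMap F) :
    ∃ G, IsPolyMap G ∧ ∀ z : ℂ, ‖z‖ = 1 → ‖G z‖ = ‖F z‖ ∧
      ∀ c : ℂ, ‖F z + c • G z‖ ^ 2 = (1 + ‖c‖ ^ 2) * ‖F z‖ ^ 2 := by
  obtain ⟨p, q, rfl⟩ := hF
  obtain ⟨M₁, h₁⟩ := exists_eval_eq_pow_mul_conj p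
  obtain ⟨M₂, h₂⟩ := exists_eval_eq_pow_mul_conj q
  obtain ⟨p', hp'⟩ := h₁ (max M₁ M₂) (le_max_left _ _)
  obtain ⟨q', hq'⟩ := h₂ (max M₁ M₂) (le_max_right _ _)
  refine ⟨_, ⟨-q', p', rfl⟩, fun z hz => ⟨?_, fun c => ?_⟩⟩
  · simp only [EuclideanSpace.norm_eq, Fin.sum_univ_two]
    simp [hp' z hz, hq' z hz, hz, add_comm]
  · have hc : ‖c‖ = ‖c * z ^ max M₁ M₂‖ := by simp [hz]
    simp only [EuclideanSpace.norm_sq_eq, Fin.sum_univ_two]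
    simp only [PiLp.add_apply, PiLp.smul_apply, Matrix.cons_val_zero, Matrix.cons_val_one,
      eval_neg, hp' z hz, hq' z hz, smul_eq_mul, Matrix.cons_val_fin_one]
    rw [hc, show c * -(z ^ max M₁ M₂ * (starRingEnd ℂ) (eval z q)) =
        -((c * z ^ max M₁ M₂) * (starRingEnd ℂ) (eval z q)) by ring, ← mul_assoc]
    generalize c * z ^ max M₁ M₂ = d
    generalize eval z p = x
    generalize eval z q = y
    simp only [Complex.sq_norm, Complex.normSq_apply, Complex.add_re, Complex.add_im,
      Complex.neg_re, Complex.neg_im, Complex.mul_re, Complex.mul_im, Complex.conj_re,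
      Complex.conj_im]
    ring

/-- A polynomial map can be perturbed uniformly little so that crossings near the circle become
long. -/
lemma IsPolyMap.exists_stablyCrosses {f : ℂ → EuclideanSpace ℂ (Fin 2)} (hf : IsPolyMap f)
    {a δ η : ℝ} (ha : 0 ≤ a) (ha1 : a < 1) (hδ : 0 < δ) (hη : 0 < η) :
    ∃ F, IsPolyMap F ∧ (∀ z, ‖z‖ ≤ 1 → ‖F z - f z‖ ≤ δ) ∧ LipClose η a F f ∧
      ∃ b, a ≤ b ∧ b < 1 ∧ StablyCrosses F a b 1 := by
  have iterate : ∀ (d ε : ℝ), 0 < d → 0 < ε → ∀ (k : ℕ) (η : ℝ), 0 < η → ∃ D, IsPolyMap D ∧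
      (∀ z, ‖z‖ = 1 → ‖D z‖ ^ 2 = (1 + ε ^ 2) ^ k * d ^ 2) ∧
      LipClose η a (fun z => f z + D z) f ∧ ∃ b, a ≤ b ∧ b < 1 ∧
        StablyCrosses (fun z => f z + D z) a b (ENNReal.ofReal (k * (ε * d / 128))) := by
    intro d ε hd hε k
    induction k with
    | zero =>
      intro η hη
      refine ⟨_, isPolyMap_const (EuclideanSpace.single 0 (d : ℂ)), fun z _ => ?_, ?_, a, le_rfl,
        ha1, ?_⟩
      · simp
      · intro z w _ _
        simp only [add_sub_cancel_left, sub_self, norm_zero]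
        positivity
      · simpa using StablyCrosses.zero _ a a
    | succ k ih =>
      intro η hη
      obtain ⟨D, hD, hDn, hDf, b, hab, hb1, hDb⟩ := ih (η / 2) (half_pos hη)
      obtain ⟨e, he, hstab⟩ := hDb.exists_forall_lipClose
      obtain ⟨G, hG, hGD⟩ := hD.exists_orthogonal
      have hP : IsPolyMap fun z => (ε : ℂ) • G z := by simpa using hG.smul (C (ε : ℂ))
      have hH : IsPolyMap fun z => f z + D z := hf.add hD
      have hlow : ∀ z : ℂ, ‖z‖ = 1 → ε * d ≤ ‖(ε : ℂ) • G z‖ := fun z hz => by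
        rw [norm_smul, Complex.norm_real, Real.norm_of_nonneg hε.le, (hGD z hz).1]
        gcongr
        refine (sq_le_sq₀ hd.le (norm_nonneg _)).1 ?_
        rw [hDn z hz]
        exact le_mul_of_one_le_left (sq_nonneg d) (one_le_pow₀ (by nlinarith))
      obtain ⟨N, hN, b', hbb', hb'1, hN'⟩ := ((eventually_lipClose_add_pow_smul hH.differentiable
        hP.contDiff (ha.trans hab) hb1 (lt_min (half_pos hη) he)).and
        (eventually_stablyCrosses_add_pow_smul hH.contDiff hP.contDiff hb1 (mul_pos hε hd)
          hlow)).exists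
      have hassoc : (fun z => f z + (D z + z ^ N • (ε : ℂ) • G z)) =
          fun z => f z + D z + z ^ N • (ε : ℂ) • G z := funext fun z => (add_assoc _ _ _).symm
      refine ⟨_, hD.add (hP.pow_smul N), fun z hz => ?_, ?_, b', hab.trans hbb'.le, hb'1, ?_⟩
      · rw [smul_smul, (hGD z hz).2, hDn z hz]
        simp [hz, pow_succ, abs_of_pos hε]
        ring
      · rw [hassoc]
        refine ((hN.mono (min_le_left _ _) hab).trans hDf).mono (by linarith) le_rfl
      · rw [hassoc]
        refine ((hstab _ (hN.mono (min_le_right _ _) le_rfl)).trans hN' hab hbb'.le).mono_length ?_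
        rw [← ENNReal.ofReal_add (by positivity) (by positivity)]
        apply ENNReal.ofReal_le_ofReal
        push_cast
        linarith
  obtain ⟨n, hn⟩ := exists_nat_ge (max (256 / δ) 1)
  have hn1 : (1 : ℝ) ≤ n := (le_max_right _ _).trans hn
  have hnδ : 256 / δ ≤ n := (le_max_left _ _).trans hn
  have hn0 : (0 : ℝ) < n := by linarith
  obtain ⟨D, hD, hDn, hDf, b, hab, hb1, hDb⟩ :=
    iterate (δ / 2) (1 / n) (half_pos hδ) (by positivity) (n ^ 2) η hη
  refine ⟨_, hf.add hD, fun z hz => ?_, hDf, b, hab, hb1, hDb.mono_length ?_⟩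
  · rw [add_sub_cancel_left]
    refine norm_le_of_forall_norm_eq_one hD.differentiable (fun w hw => ?_) hz
    refine (sq_le_sq₀ (norm_nonneg _) hδ.le).1 ?_
    have hexp : (1 + (1 / (n : ℝ)) ^ 2) ^ n ^ 2 ≤ 4 := by
      calc (1 + (1 / (n : ℝ)) ^ 2) ^ n ^ 2 ≤ (Real.exp ((1 / (n : ℝ)) ^ 2)) ^ n ^ 2 := by
            gcongr
            linarith [Real.add_one_le_exp ((1 / (n : ℝ)) ^ 2)]
        _ = Real.exp 1 := by
            rw [← Real.exp_nat_mul]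
            congr 1
            push_cast
            field_simp
        _ ≤ 4 := by linarith [Real.exp_one_lt_d9]
    rw [hDn w hw]
    calc _ ≤ 4 * (δ / 2) ^ 2 := by gcongr
      _ = δ ^ 2 := by ring
  · rw [← ENNReal.ofReal_one]
    apply ENNReal.ofReal_le_ofReal
    rw [div_le_iff₀ hδ] at hnδ
    push_cast
    have h1 : (n : ℝ) ^ 2 * (1 / n * (δ / 2) / 128) = n * δ / 256 := by
      field_simp
      ring
    rw [h1]
    linarith

/-- A polynomial map becomes an immersion after adding a small generic linear map. -/
lemma IsPolyMap.exists_deriv_add_ne_zero {F : ℂ → EuclideanSpace ℂ (Fin 2)} (hF : IsPolyMap F)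
    {δ : ℝ} (hδ : 0 < δ) : ∃ v : EuclideanSpace ℂ (Fin 2), ‖v‖ < δ ∧ ∀ z, deriv F z + v ≠ 0 := by
  have hd : ContDiff ℂ 1 (deriv F) := by
    have h2 : ContDiff ℂ (1 + 1) F := hF.contDiff (n := 2)
    exact (contDiff_succ_iff_deriv.1 h2).2.2
  have hdense := (hd.restrict_scalars ℝ).dense_compl_range_of_finrank_lt_finrank (by
    rw [Complex.finrank_real_complex, ← Module.finrank_mul_finrank ℝ ℂ,
      Complex.finrank_real_complex, finrank_euclideanSpace_fin]
    norm_num)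
  obtain ⟨v, hv, hv'⟩ := hdense.exists_dist_lt 0 hδ
  refine ⟨-v, by simpa using hv', fun z hz => hv ⟨z, ?_⟩⟩
  exact eq_of_sub_eq_zero (by rw [sub_eq_add_neg, hz])

end PolynomialMaps

/-! ### Polynomials with prescribed modulus on the circle -/

section Approximation

/-- Trigonometric polynomials are dense: a real continuous function on the unit circle is
uniformly close to the real part of a polynomial. -/
lemma exists_polynomial_re_approx {v : ℂ → ℝ} (hv : ContinuousOn v (sphere 0 1)) {τ : ℝ}
    (hτ : 0 < τ) : ∃ p : ℂ[X], ∀ z : ℂ, ‖z‖ = 1 → |(p.eval z).re - v z| < τ := by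
  have : Fact (0 < 2 * Real.pi) := ⟨Real.two_pi_pos⟩
  have hcont : Continuous fun x : AddCircle (2 * Real.pi) => (v (x.toCircle : ℂ) : ℂ) :=
    Complex.continuous_ofReal.comp (hv.comp_continuous
      (continuous_subtype_val.comp AddCircle.continuous_toCircle) fun x =>
        mem_sphere_zero_iff_norm.2 (Circle.norm_coe _))
  let g : C(AddCircle (2 * Real.pi), ℂ) := ⟨_, hcont⟩
  have hg : g ∈ closure ((Submodule.span ℂ (range (@fourier (2 * Real.pi)))) :
      Set C(AddCircle (2 * Real.pi), ℂ)) := by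
    rw [← Submodule.topologicalClosure_coe, span_fourier_closure_eq_top]
    trivial
  obtain ⟨h, hh, hgh⟩ := Metric.mem_closure_iff.1 hg τ hτ
  have hrep : ∃ p q : ℂ[X], ∀ x : AddCircle (2 * Real.pi),
      h x = p.eval (x.toCircle : ℂ) + (starRingEnd ℂ) (q.eval (x.toCircle : ℂ)) := by
    clear hgh
    induction hh using Submodule.span_induction with
    | mem f hf =>
      obtain ⟨n, rfl⟩ := hf
      obtain ⟨m, rfl | rfl⟩ := n.eq_nat_or_neg
      · exact ⟨X ^ m, 0, fun x => by simp [AddCircle.toCircle_nsmul]⟩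
      · refine ⟨0, X ^ m, fun x => ?_⟩
        simp [AddCircle.toCircle_nsmul, AddCircle.toCircle_neg, ← inv_pow,
          ← Circle.coe_inv_eq_conj]
    | zero => exact ⟨0, 0, fun x => by simp⟩
    | add f f' _ _ ih ih' =>
      obtain ⟨p, q, hpq⟩ := ih
      obtain ⟨p', q', hpq'⟩ := ih'
      refine ⟨p + p', q + q', fun x => ?_⟩
      simp only [ContinuousMap.add_apply, hpq, hpq', eval_add, map_add]
      ring
    | smul c f _ ih =>
      obtain ⟨p, q, hpq⟩ := ih
      refine ⟨C c * p, C ((starRingEnd ℂ) c) * q, fun x => ?_⟩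
      simp only [ContinuousMap.smul_apply, hpq, eval_mul, eval_C, map_mul, smul_eq_mul,
        Complex.conj_conj]
      ring
  obtain ⟨p, q, hpq⟩ := hrep
  refine ⟨p + q, fun z hz => ?_⟩
  obtain ⟨x, rfl⟩ : ∃ x : AddCircle (2 * Real.pi), (x.toCircle : ℂ) = z := by
    refine ⟨((Complex.arg z : ℝ) : AddCircle (2 * Real.pi)), ?_⟩
    rw [AddCircle.toCircle_apply_mk, div_self Real.two_pi_pos.ne', one_mul, Circle.coe_exp]
    simpa [hz] using Complex.norm_mul_exp_arg_mul_I z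
  have h1 : ‖g x - h x‖ < τ := by
    rw [← dist_eq_norm]
    exact (ContinuousMap.dist_apply_le_dist x).trans_lt hgh
  have h2 := (Complex.abs_re_le_norm (g x - h x)).trans_lt h1
  rw [hpq] at h2
  simp only [g, ContinuousMap.coe_mk, Complex.sub_re, Complex.add_re, Complex.conj_re,
    Complex.ofReal_re] at h2
  rw [abs_sub_comm] at h2
  simpa using h2

/-- On the unit circle the exponential of a polynomial is uniformly approximated by
polynomials. -/
lemma exists_polynomial_exp_approx (p : ℂ[X]) {τ : ℝ} (hτ : 0 < τ) :
    ∃ c : ℂ[X], ∀ z : ℂ, ‖z‖ = 1 → ‖c.eval z - Complex.exp (p.eval z)‖ < τ := by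
  obtain ⟨B, hB⟩ := (isCompact_sphere (0 : ℂ) 1).exists_bound_of_continuousOn
    p.continuous.continuousOn
  have hu := tendstoUniformlyOn_tsum_nat (f := fun (n : ℕ) (z : ℂ) => (p.eval z) ^ n / n.factorial)
    (s := sphere (0 : ℂ) 1) (Real.summable_pow_div_factorial B) (fun n z hz => by
      rw [norm_div, norm_pow, Complex.norm_natCast]
      gcongr
      exact hB z hz)
  obtain ⟨N, hN⟩ := (Metric.tendstoUniformlyOn_iff.1 hu τ hτ).exists
  refine ⟨∑ n ∈ Finset.range N, C ((n.factorial : ℂ)⁻¹) * p ^ n, fun z hz => ?_⟩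
  have h1 := hN z (by simpa using hz)
  rw [dist_comm, dist_eq_norm] at h1
  rw [Complex.exp_eq_exp_ℂ, NormedSpace.exp_eq_tsum_div]
  refine lt_of_le_of_lt (le_of_eq ?_) h1
  congr 2
  rw [eval_finsetSum]
  refine Finset.sum_congr rfl fun n _ => ?_
  rw [eval_mul, eval_C, eval_pow, div_eq_inv_mul]

/-- A positive continuous function on the circle is, up to a factor arbitrarily close to `1`,
the modulus of a polynomial. -/
lemma exists_polynomial_norm_approx {w : ℂ → ℝ} (hw : ContinuousOn w (sphere 0 1))
    (hpos : ∀ z, ‖z‖ = 1 → 0 < w z) {κ : ℝ} (hκ : 1 < κ) :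
    ∃ c : ℂ[X], ∀ z : ℂ, ‖z‖ = 1 → w z ≤ κ * ‖c.eval z‖ ∧ ‖c.eval z‖ ≤ κ * w z := by
  have hlogκ : 0 < Real.log κ := Real.log_pos hκ
  obtain ⟨p, hp⟩ := exists_polynomial_re_approx (v := fun z => Real.log (w z))
    (hw.log fun z hz => (hpos z (by simpa using hz)).ne') (half_pos hlogκ)
  obtain ⟨B, hB⟩ := (isCompact_sphere (0 : ℂ) 1).exists_bound_of_continuousOn
    p.continuous.continuousOn
  set l := Real.exp (Real.log κ / 2) with hl
  have hl1 : 1 < l := Real.one_lt_exp_iff.2 (half_pos hlogκ)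
  have hl0 : 0 < l := by linarith
  have hll : l * l = κ := by
    rw [hl, ← Real.exp_add, add_halves, Real.exp_log (by linarith)]
  obtain ⟨c, hc⟩ := exists_polynomial_exp_approx p
    (τ := Real.exp (-B) * (1 - 1 / l)) (mul_pos (Real.exp_pos _) (by
      rw [sub_pos, div_lt_one hl0]
      exact hl1))
  refine ⟨c, fun z hz => ?_⟩
  have hw0 := hpos z hz
  obtain ⟨h1, h2⟩ := abs_lt.1 (hp z hz)
  set x := Real.exp (p.eval z).re with hx
  have hx0 : 0 < x := Real.exp_pos _
  have hnorm : ‖Complex.exp (p.eval z)‖ = x := Complex.norm_exp _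
  have hwx : w z ≤ l * x := by
    rw [hl, hx, ← Real.exp_add, ← Real.exp_log hw0]
    apply Real.exp_le_exp.2
    linarith
  have hxw : x ≤ l * w z := by
    calc x ≤ Real.exp (Real.log κ / 2 + Real.log (w z)) := Real.exp_le_exp.2 (by linarith)
      _ = l * w z := by rw [Real.exp_add, Real.exp_log hw0]
  have hxB : Real.exp (-B) ≤ x := by
    apply Real.exp_le_exp.2
    have := (Complex.abs_re_le_norm _).trans (hB z (by simpa using hz))
    linarith [(abs_le.1 this).1]
  have hcz := hc z hz
  have hinv : 0 < 1 - 1 / l := by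
    rw [sub_pos, div_lt_one hl0]
    exact hl1
  have hcx : ‖c.eval z - Complex.exp (p.eval z)‖ ≤ x * (1 - 1 / l) :=
    hcz.le.trans (by gcongr)
  have h3 := norm_sub_norm_le (c.eval z) (Complex.exp (p.eval z))
  have h4 := norm_sub_norm_le (Complex.exp (p.eval z)) (c.eval z)
  rw [norm_sub_rev] at h4
  rw [hnorm] at h3 h4
  have h5 : x ≤ l * ‖c.eval z‖ := by
    have h6 : l * (x * (1 - 1 / l)) = l * x - x := by
      field_simp
    have h7 : l * (x - ‖c.eval z‖) ≤ l * (x * (1 - 1 / l)) := by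
      gcongr
      linarith
    linarith
  have h6 : ‖c.eval z‖ ≤ l * x := by
    have h7 : 1 - 1 / l ≤ l - 1 := by
      have h8 : l - 1 - (1 - 1 / l) = (l - 1) ^ 2 / l := by
        field_simp
      have h9 : 0 ≤ (l - 1) ^ 2 / l := by positivity
      linarith
    have h8 : x * (1 - 1 / l) ≤ x * (l - 1) := by gcongr
    linarith
  constructor
  · calc w z ≤ l * x := hwx
      _ ≤ l * (l * ‖c.eval z‖) := by gcongr
      _ = κ * ‖c.eval z‖ := by rw [← hll, mul_assoc]
  · calc ‖c.eval z‖ ≤ l * x := h6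
      _ ≤ l * (l * w z) := by gcongr
      _ = κ * w z := by rw [← hll, mul_assoc]

end Approximation

/-! ### Pushing the boundary of a polynomial disc towards the sphere -/

section Push

lemma exists_uniform_gap {E : Type*} [NormedAddCommGroup E] {F : ℂ → E} (hF : Continuous F)
    {α β : ℝ} (h : ∀ z, ‖z‖ = 1 → α < ‖F z‖ ∧ ‖F z‖ < β) :
    ∃ δ > 0, ∀ z, ‖z‖ = 1 → α + δ ≤ ‖F z‖ ∧ ‖F z‖ + δ ≤ β := by
  obtain ⟨δ, hδ, hδF⟩ := (isCompact_sphere (0 : ℂ) 1).exists_forall_le' (a := 0)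
    (f := fun z => min (‖F z‖ - α) (β - ‖F z‖))
    (((hF.norm.sub continuous_const).min (continuous_const.sub hF.norm)).continuousOn)
    (fun z hz => by
      obtain ⟨h1, h2⟩ := h z (by simpa using hz)
      exact lt_min (sub_pos.2 h1) (sub_pos.2 h2))
  refine ⟨δ, hδ, fun z hz => ?_⟩
  have h1 := hδF z (by simpa using hz)
  obtain ⟨h2, h3⟩ := le_min_iff.1 h1
  constructor <;> linarith

lemma IsPolyMap.exists_push {F : ℂ → EuclideanSpace ℂ (Fin 2)} (hF : IsPolyMap F)
    {α a η τ : ℝ} (hα : 0 ≤ α) (h : ∀ z, ‖z‖ = 1 → α < ‖F z‖ ∧ ‖F z‖ < 1) (ha : 0 ≤ a)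
    (ha1 : a < 1) (hη : 0 < η) (hτ : 0 < τ) :
    ∃ G, IsPolyMap G ∧ LipClose η a G F ∧ ∀ z, ‖z‖ = 1 →
      1 - τ < ‖G z‖ ∧ ‖G z‖ < 1 ∧ ‖G z - F z‖ ^ 2 ≤ 1 - α ^ 2 := by
  obtain ⟨δ, hδ, hδF⟩ := exists_uniform_gap hF.differentiable.continuous h
  obtain ⟨ρ, hρ0, hρ1, hρδ, hρτ⟩ : ∃ ρ : ℝ, 0 < ρ ∧ ρ < 1 ∧ ρ ≤ δ ∧ ρ ≤ τ :=
    ⟨min (1 / 2) (min δ τ), lt_min (by norm_num) (lt_min hδ hτ), by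
      linarith [min_le_left (1 / 2) (min δ τ)], (min_le_right _ _).trans (min_le_left _ _),
      (min_le_right _ _).trans (min_le_right _ _)⟩
  set R := 1 - ρ / 2 with hR
  have hFR : ∀ z, ‖z‖ = 1 → 0 < ‖F z‖ ∧ ‖F z‖ < R := fun z hz => by
    have h1 := (hδF z hz).2
    exact ⟨hα.trans_lt (h z hz).1, by linarith⟩
  have hwpos : ∀ z, ‖z‖ = 1 → 0 < R ^ 2 / ‖F z‖ ^ 2 - 1 := fun z hz => by
    obtain ⟨h1, h2⟩ := hFR z hz
    rw [sub_pos, one_lt_div (by positivity)]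
    gcongr
  obtain ⟨c, hc⟩ := exists_polynomial_norm_approx
    (w := fun z => Real.sqrt (R ^ 2 / ‖F z‖ ^ 2 - 1)) (κ := 1 + ρ / 4)
    (by
      refine ContinuousOn.sqrt ((continuousOn_const.div
        (hF.differentiable.continuous.norm.pow 2).continuousOn fun z hz => ?_).sub
        continuousOn_const)
      exact pow_ne_zero 2 (hFR z (by simpa using hz)).1.ne')
    (fun z hz => Real.sqrt_pos.2 (hwpos z hz)) (by linarith)
  obtain ⟨P, hP, hPF⟩ := hF.exists_orthogonal
  have hcP := hP.smul c
  obtain ⟨N, hN⟩ := (eventually_lipClose_add_pow_smul hF.differentiable (hcP.contDiff (n := 1))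
    ha ha1 hη).exists
  refine ⟨_, hF.add (hcP.pow_smul N), hN, fun z hz => ?_⟩
  obtain ⟨hF0, hF1⟩ := hFR z hz
  obtain ⟨hPn, hPs⟩ := hPF z hz
  obtain ⟨hc1, hc2⟩ := hc z hz
  have hsq := Real.sq_sqrt (hwpos z hz).le
  set w := Real.sqrt (R ^ 2 / ‖F z‖ ^ 2 - 1)
  have hw0 : 0 ≤ w := Real.sqrt_nonneg _
  have hzc : ‖z ^ N * c.eval z‖ = ‖c.eval z‖ := by simp [hz]
  have hG := hPs (z ^ N * c.eval z)
  have hdiff : ‖F z + z ^ N • c.eval z • P z - F z‖ ^ 2 = ‖c.eval z‖ ^ 2 * ‖F z‖ ^ 2 := by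
    rw [add_sub_cancel_left, smul_smul, norm_smul, hzc, hPn, mul_pow]
  rw [hzc, ← smul_smul] at hG
  have hwF : (1 + w ^ 2) * ‖F z‖ ^ 2 = R ^ 2 := by
    rw [hsq]
    field_simp
    ring
  have hlow : R ^ 2 ≤ ((1 + ρ / 4) * ‖F z + z ^ N • c.eval z • P z‖) ^ 2 := by
    rw [mul_pow, hG, ← hwF, ← mul_assoc]
    gcongr
    have h1 : w ^ 2 ≤ ((1 + ρ / 4) * ‖c.eval z‖) ^ 2 := by gcongr
    have h2 : 1 ≤ (1 + ρ / 4) ^ 2 := one_le_pow₀ (by linarith)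
    rw [mul_pow] at h1
    linarith
  have hupp : ‖F z + z ^ N • c.eval z • P z‖ ^ 2 ≤ ((1 + ρ / 4) * R) ^ 2 := by
    rw [mul_pow, hG, ← hwF, ← mul_assoc]
    gcongr
    have h1 : ‖c.eval z‖ ^ 2 ≤ ((1 + ρ / 4) * w) ^ 2 := by gcongr
    have h2 : 1 ≤ (1 + ρ / 4) ^ 2 := one_le_pow₀ (by linarith)
    rw [mul_pow] at h1
    linarith
  have hR0 : 0 ≤ R := by linarith
  have hlow' := (sq_le_sq₀ hR0 (by positivity)).1 hlow
  have hupp' := (sq_le_sq₀ (norm_nonneg _) (by positivity)).1 hupp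
  have hlt : ‖F z + z ^ N • c.eval z • P z‖ < 1 := by
    refine hupp'.trans_lt ?_
    rw [hR]
    nlinarith
  refine ⟨?_, hlt, ?_⟩
  · by_contra! hcon
    have h1 : (1 + ρ / 4) * ‖F z + z ^ N • c.eval z • P z‖ ≤ (1 + ρ / 4) * (1 - ρ) := by
      gcongr
      linarith
    nlinarith
  · rw [hdiff]
    have h1 : ‖F z + z ^ N • c.eval z • P z‖ ^ 2 ≤ 1 := pow_le_one₀ (norm_nonneg _) hlt.le
    have h2 : α ^ 2 ≤ ‖F z‖ ^ 2 := by
      gcongr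
      exact (h z hz).1.le
    linarith

end Push

/-! ### The inductive step -/

section Step

lemma lipClose_add_smul_const {E : Type*} [NormedAddCommGroup E] [NormedSpace ℂ E] (F : ℂ → E)
    (v : E) (b : ℝ) : LipClose ‖v‖ b (fun z => F z + z • v) F := fun z w _ _ => by
  rw [add_sub_cancel_left, add_sub_cancel_left, ← sub_smul, norm_smul, mul_comm]

lemma IsPolyMap.exists_improve {F : ℂ → EuclideanSpace ℂ (Fin 2)} (hF : IsPolyMap F)
    {σ a r η : ℝ} (hσ : 0 < σ) (hσ1 : σ < 1)
    (h : ∀ z, ‖z‖ = 1 → 1 - σ ^ 2 < ‖F z‖ ∧ ‖F z‖ < 1) (ha : 0 ≤ a) (ha1 : a < 1) (hr : r < 1)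
    (hη : 0 < η) :
    ∃ G, IsPolyMap G ∧ (∀ z, ‖z‖ = 1 → 1 - (σ / 2) ^ 2 < ‖G z‖ ∧ ‖G z‖ < 1) ∧
      (∀ z, ‖z‖ ≤ 1 → ‖G z - F z‖ ≤ 4 * σ) ∧ LipClose η a G F ∧ (∀ z, deriv G z ≠ 0) ∧
      ∃ b, a ≤ b ∧ r ≤ b ∧ b < 1 ∧ StablyCrosses G a b 1 := by
  obtain ⟨δ₁, hδ₁, hgap₁⟩ := exists_uniform_gap hF.differentiable.continuous h
  obtain ⟨F₁, hF₁, hF₁F, hlip₁, b₀, hab₀, hb₀, hcross⟩ := hF.exists_stablyCrosses ha ha1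
    (lt_min (half_pos hδ₁) (pow_pos hσ 2)) (div_pos hη four_pos)
  obtain ⟨b, hab, hrb, hb₀b, hb⟩ : ∃ b, a ≤ b ∧ r ≤ b ∧ b₀ ≤ b ∧ b < 1 :=
    ⟨max b₀ r, hab₀.trans (le_max_left _ _), le_max_right _ _, le_max_left _ _, max_lt hb₀ hr⟩
  obtain ⟨e, he, hstab⟩ := (hcross.mono_right hab₀ hb₀b).exists_forall_lipClose
  have hcirc₁ : ∀ z, ‖z‖ = 1 → 1 - σ ^ 2 < ‖F₁ z‖ ∧ ‖F₁ z‖ < 1 := fun z hz => by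
    obtain ⟨h1, h2⟩ := hgap₁ z hz
    have h3 := abs_le.1 ((abs_norm_sub_norm_le _ _).trans
      ((hF₁F z hz.le).trans (min_le_left _ _)))
    constructor <;> linarith [h3.1, h3.2]
  have hσ2 : σ ^ 2 < 1 := pow_lt_one₀ hσ.le hσ1 two_ne_zero
  obtain ⟨F₂, hF₂, hlip₂, hpush⟩ := hF₁.exists_push (sub_nonneg.2 hσ2.le) hcirc₁
    (ha.trans hab) hb (lt_min (div_pos hη four_pos) (half_pos he))
    (τ := (σ / 2) ^ 2) (by positivity)
  have hF₂F₁ : ∀ z, ‖z‖ ≤ 1 → ‖F₂ z - F₁ z‖ ≤ 2 * σ := fun z hz =>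
    norm_le_of_forall_norm_eq_one (F := fun z => F₂ z - F₁ z)
      (hF₂.differentiable.sub hF₁.differentiable) (fun w hw => by
        refine (sq_le_sq₀ (norm_nonneg _) (by positivity)).1 ((hpush w hw).2.2.trans ?_)
        nlinarith [sq_nonneg (σ ^ 2)]) hz
  obtain ⟨δ₂, hδ₂, hgap₂⟩ := exists_uniform_gap hF₂.differentiable.continuous
    fun z hz => ⟨(hpush z hz).1, (hpush z hz).2.1⟩
  obtain ⟨v, hv, hderiv⟩ := hF₂.exists_deriv_add_ne_zero
    (lt_min (lt_min hδ₂ hσ) (lt_min (div_pos hη four_pos) (half_pos he)))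
  obtain ⟨⟨hvδ, hvσ⟩, hvη, hve⟩ : (‖v‖ < δ₂ ∧ ‖v‖ < σ) ∧ ‖v‖ < η / 4 ∧ ‖v‖ < e / 2 := by
    simpa only [lt_min_iff] using hv
  have hlip₃ := lipClose_add_smul_const F₂ v
  have hzv : ∀ z : ℂ, ‖z‖ ≤ 1 → ‖F₂ z + z • v - F₂ z‖ ≤ ‖v‖ := fun z hz => by
    rw [add_sub_cancel_left, norm_smul]
    exact mul_le_of_le_one_left (norm_nonneg _) hz
  refine ⟨fun z => F₂ z + z • v, hF₂.add (isPolyMap_smul_const v), fun z hz => ?_,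
    fun z hz => ?_, ?_, fun z => ?_, b, hab, hrb, hb, hstab _ ?_⟩
  · obtain ⟨h1, h2⟩ := hgap₂ z hz
    have h3 := abs_le.1 ((abs_norm_sub_norm_le _ _).trans (hzv z hz.le))
    constructor <;> linarith [h3.1, h3.2]
  · have h1 := norm_add_le_of_le (norm_add_le_of_le (hzv z hz) (hF₂F₁ z hz))
      ((hF₁F z hz).trans (min_le_right _ _))
    rw [sub_add_sub_cancel, sub_add_sub_cancel] at h1
    nlinarith
  · refine (((hlip₃ a).trans (hlip₂.mono (min_le_left _ _) hab)).trans hlip₁).mono ?_ le_rfl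
    linarith
  · rw [deriv_fun_add hF₂.differentiable.differentiableAt (by fun_prop),
      deriv_smul_const differentiableAt_fun_id]
    simpa using hderiv z
  · exact ((hlip₃ b).trans (hlip₂.mono (min_le_right _ _) le_rfl)).mono (by linarith) le_rfl

/-- The inductive step of the construction: besides approximating the previous map, the new map
and all maps close to it have long crossings and no critical points. -/
lemma IsPolyMap.exists_step {F : ℂ → EuclideanSpace ℂ (Fin 2)} (hF : IsPolyMap F)
    {σ a r e : ℝ} (hσ : 0 < σ) (hσ1 : σ < 1)
    (h : ∀ z, ‖z‖ = 1 → 1 - σ ^ 2 < ‖F z‖ ∧ ‖F z‖ < 1) (ha : 0 ≤ a) (ha1 : a < 1) (hr : r < 1)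
    (he : 0 < e) :
    ∃ G b e', IsPolyMap G ∧ (∀ z, ‖z‖ = 1 → 1 - (σ / 2) ^ 2 < ‖G z‖ ∧ ‖G z‖ < 1) ∧
      (∀ z, ‖z‖ ≤ 1 → ‖G z - F z‖ ≤ 4 * σ) ∧ a ≤ b ∧ r ≤ b ∧ b < 1 ∧ 0 < e' ∧
      ∀ φ, LipClose e' b φ G → LipClose e a φ F ∧ CrossingLength φ a b 1 ∧
        ∀ z, ‖z‖ < b → DifferentiableAt ℂ φ z → deriv φ z ≠ 0 := by
  obtain ⟨G, hG, hcirc, hGF, hlip, hderiv, b, hab, hrb, hb, e₁, he₁, hcross⟩ :=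
    hF.exists_improve hσ hσ1 h ha ha1 hr (half_pos he)
  obtain ⟨m, hm, hGm⟩ := (isCompact_closedBall (0 : ℂ) b).exists_forall_le' (a := 0)
    (f := fun z => ‖deriv G z‖)
    (((hG.contDiff (n := 1)).continuous_deriv le_rfl).norm.continuousOn)
    (fun z _ => norm_pos_iff.2 (hderiv z))
  refine ⟨G, b, min (e / 2) (min e₁ (m / 2)), hG, hcirc, hGF, hab, hrb, hb,
    lt_min (half_pos he) (lt_min he₁ (half_pos hm)), fun φ hφ => ⟨?_, ?_, fun z hz hφz h0 => ?_⟩⟩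
  · exact ((hφ.mono (min_le_left _ _) hab).trans hlip).mono (by linarith) le_rfl
  · exact hcross φ (hφ.mono ((min_le_right _ _).trans (min_le_left _ _)) le_rfl)
  · have h1 : LipClose (m / 2) b φ G :=
      hφ.mono ((min_le_right _ _).trans (min_le_right _ _)) le_rfl
    have h2 : HasDerivAt (fun z => φ z - G z) (deriv φ z - deriv G z) z :=
      hφz.hasDerivAt.fun_sub (hG.differentiable z).hasDerivAt
    have h3 : ‖deriv φ z - deriv G z‖ ≤ m / 2 := by
      refine h2.le_of_lip' (half_pos hm).le ?_
      filter_upwards [isOpen_ball.mem_nhds (mem_ball_zero_iff.2 hz)] with w hw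
      exact h1 w z (mem_ball_zero_iff.1 hw).le hz.le
    rw [h0, zero_sub, norm_neg] at h3
    have := hGm z (mem_closedBall_zero_iff.2 hz.le)
    linarith

end Step

/-! ### The limit disc -/

section Limit

lemma exists_dependent_seq {α : Type*} {P : ℕ → α → Prop} {R : ℕ → α → α → Prop} {p₀ : α}
    (h₀ : P 0 p₀) (h : ∀ k p, P k p → ∃ q, P (k + 1) q ∧ R k p q) :
    ∃ s : ℕ → α, ∀ k, P k (s k) ∧ R k (s k) (s (k + 1)) := by
  choose! f hf hR using h
  let s : ℕ → α := fun k => Nat.rec p₀ f k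
  have hs : ∀ k, P k (s k) := fun k => by
    induction k with
    | zero => exact h₀
    | succ k ih => exact hf k _ ih
  exact ⟨s, fun k => ⟨hs k, hR k _ (hs k)⟩⟩

lemma LipClose.of_tendsto {E : Type*} [NormedAddCommGroup E] {e b : ℝ} {φ F : ℂ → E}
    {G : ℕ → ℂ → E} (hG : ∀ z, ‖z‖ ≤ b → Tendsto (fun m => G m z) atTop (𝓝 (φ z)))
    (h : ∀ᶠ m in atTop, LipClose e b (G m) F) : LipClose e b φ F := fun z w hz hw =>
  le_of_tendsto (((hG z hz).sub_const _).sub ((hG w hw).sub_const _)).norm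
    (h.mono fun _ hm => hm z w hz hw)

/-- There is a complete immersed disc in `ℂ²` with boundary in the unit sphere. -/
lemma exists_complete_disc_fin_two :
    ∃ φ : ℂ → EuclideanSpace ℂ (Fin 2), ContinuousOn φ (closedBall 0 1) ∧
      DifferentiableOn ℂ φ (ball 0 1) ∧ (∀ z, ‖z‖ = 1 → ‖φ z‖ = 1) ∧
      (∀ z ∈ ball (0 : ℂ) 1, deriv φ z ≠ 0) ∧
      ∀ γ : ℝ → ℂ, DivergentPathIn (ball (0 : ℂ) 1) γ →
        eVariationOn (fun t => φ (γ t)) (Ico 0 1) = ⊤ := by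
  obtain ⟨s, hs⟩ := exists_dependent_seq (α := (ℂ → EuclideanSpace ℂ (Fin 2)) × ℝ × ℝ)
    (P := fun k p => IsPolyMap p.1 ∧ 0 ≤ p.2.1 ∧ p.2.1 < 1 ∧ 0 < p.2.2 ∧
      ∀ z, ‖z‖ = 1 → 1 - ((1 / 2 : ℝ) ^ (k + 1)) ^ 2 < ‖p.1 z‖ ∧ ‖p.1 z‖ < 1)
    (R := fun k p q => (∀ z, ‖z‖ ≤ 1 → ‖q.1 z - p.1 z‖ ≤ 4 * (1 / 2 : ℝ) ^ (k + 1)) ∧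
      p.2.1 ≤ q.2.1 ∧ 1 - (1 / 2 : ℝ) ^ k ≤ q.2.1 ∧ ∀ φ, LipClose q.2.2 q.2.1 φ q.1 →
        LipClose p.2.2 p.2.1 φ p.1 ∧ CrossingLength φ p.2.1 q.2.1 1 ∧
        ∀ z, ‖z‖ < q.2.1 → DifferentiableAt ℂ φ z → deriv φ z ≠ 0)
    (p₀ := (fun _ => EuclideanSpace.single 0 (7 / 8), 0, 1))
    ⟨isPolyMap_const _, le_rfl, one_pos, one_pos, fun z _ => by
      rw [PiLp.norm_single]
      norm_num⟩
    (fun k p ⟨hp, ha, ha1, he, hcirc⟩ => by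
      obtain ⟨G, b, e', hG, hGc, hGp, hab, hrb, hb, he', hφ⟩ :=
        hp.exists_step (σ := (1 / 2) ^ (k + 1)) (r := 1 - (1 / 2) ^ k) (by positivity)
          (pow_lt_one₀ (by norm_num) (by norm_num) k.succ_ne_zero) hcirc ha ha1
          (sub_lt_self _ (by positivity)) he
      refine ⟨(G, b, e'), ⟨hG, ha.trans hab, hb, he', fun z hz => ?_⟩, hGp, hab, hrb, hφ⟩
      rw [pow_succ _ (k + 1), mul_one_div]
      exact hGc z hz)
  choose hpoly ha0 ha1 he hcirc hstep hmono hrad hclose using fun k =>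
    (⟨(hs k).1.1, (hs k).1.2.1, (hs k).1.2.2.1, (hs k).1.2.2.2.1, (hs k).1.2.2.2.2, (hs k).2⟩ :
      _ ∧ _ ∧ _ ∧ _ ∧ _ ∧ _)
  set F : ℕ → ℂ → EuclideanSpace ℂ (Fin 2) := fun k => (s k).1 with hF
  set a : ℕ → ℝ := fun k => (s k).2.1
  set e : ℕ → ℝ := fun k => (s k).2.2
  have hdist : ∀ z, ‖z‖ ≤ 1 → ∀ k, dist (F k z) (F (k + 1) z) ≤ 4 / 2 / 2 ^ k := fun z hz k => by
    rw [dist_comm, dist_eq_norm]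
    refine (hstep k z hz).trans (le_of_eq ?_)
    rw [pow_succ, one_div, inv_pow]
    ring
  have hlim : ∀ z, ∃ l, ‖z‖ ≤ 1 → Tendsto (fun k => F k z) atTop (𝓝 l) := fun z => by
    by_cases hz : ‖z‖ ≤ 1
    · obtain ⟨l, hl⟩ := cauchySeq_tendsto_of_complete (cauchySeq_of_le_geometric_two (hdist z hz))
      exact ⟨l, fun _ => hl⟩
    · exact ⟨0, fun h => absurd h hz⟩
  choose φ hφ using hlim
  have hbound : ∀ z, ‖z‖ ≤ 1 → ∀ k, dist (F k z) (φ z) ≤ 4 / 2 ^ k := fun z hz k =>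
    dist_le_of_le_geometric_two_of_tendsto (hdist z hz) (hφ z hz) k
  have hunif : TendstoUniformlyOn F φ atTop (closedBall 0 1) := by
    rw [Metric.tendstoUniformlyOn_iff]
    intro ε hε
    have h4 : Tendsto (fun k : ℕ => (4 : ℝ) / 2 ^ k) atTop (𝓝 0) :=
      tendsto_const_nhds.div_atTop (tendsto_pow_atTop_atTop_of_one_lt one_lt_two)
    filter_upwards [h4.eventually (gt_mem_nhds hε)] with k hk z hz
    rw [dist_comm]
    exact (hbound z (by simpa using hz) k).trans_lt hk
  have hdiff : DifferentiableOn ℂ φ (ball 0 1) :=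
    (hunif.mono ball_subset_closedBall).tendstoLocallyUniformlyOn.differentiableOn
      (Eventually.of_forall fun k => (hpoly k).differentiable.differentiableOn) isOpen_ball
  have ha_mono : Monotone a := monotone_nat_of_le_succ hmono
  have hnest : ∀ k m, LipClose (e k) (a k) (F (k + m)) (F k) := fun k m => by
    induction m generalizing k with
    | zero => exact LipClose.refl (he k).le _ _
    | succ m ih =>
      have h1 := ih (k + 1)
      rw [add_right_comm] at h1
      exact (hclose k _ h1).1
  have hφclose : ∀ k, LipClose (e k) (a k) φ (F k) := fun k =>
    LipClose.of_tendsto (fun z hz => hφ z (hz.trans (ha1 k).le))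
      (eventually_atTop.2 ⟨k, fun m hm => by
        obtain ⟨m, rfl⟩ := Nat.exists_eq_add_of_le hm
        exact hnest k m⟩)
  have hpow : Tendsto (fun k : ℕ => (1 / 2 : ℝ) ^ k) atTop (𝓝 0) :=
    tendsto_pow_atTop_nhds_zero_of_lt_one (by norm_num) (by norm_num)
  have ha_lim : Tendsto a atTop (𝓝 1) := by
    refine (tendsto_add_atTop_iff_nat 1).1 (tendsto_of_tendsto_of_tendsto_of_le_of_le
      (g := fun k : ℕ => 1 - (1 / 2 : ℝ) ^ k) (h := fun _ => 1) ?_ tendsto_const_nhds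
      (fun k => hrad k) fun k => (ha1 _).le)
    simpa using hpow.const_sub 1
  refine ⟨φ, hunif.continuousOn (Frequently.of_forall fun k =>
    (hpoly k).differentiable.continuous.continuousOn), hdiff, fun z hz => ?_, fun z hz => ?_,
    fun γ hγ => eVariationOn_eq_top_of_crossingLength ha_mono ha1 ha_lim
      (fun k => (hclose k φ (hφclose (k + 1))).2.1) hγ⟩
  · refine tendsto_nhds_unique (hφ z hz.le).norm ?_
    refine tendsto_of_tendsto_of_tendsto_of_le_of_le
      (g := fun k : ℕ => 1 - ((1 / 2 : ℝ) ^ (k + 1)) ^ 2) (h := fun _ => 1) ?_ tendsto_const_nhds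
      (fun k => (hcirc k z hz).1.le) fun k => (hcirc k z hz).2.le
    simpa using (((tendsto_add_atTop_iff_nat 1).2 hpow).pow 2).const_sub 1
  · have hz1 : ‖z‖ < 1 := by simpa using hz
    obtain ⟨k, hk⟩ := (((tendsto_add_atTop_iff_nat 1).2 ha_lim).eventually
      (lt_mem_nhds hz1)).exists
    exact (hclose k φ (hφclose (k + 1))).2.2 z hk
      (hdiff.differentiableAt (isOpen_ball.mem_nhds hz))

end Limit

/-! ### Discs with boundary in the unit sphere are proper -/

section Proper

variable {E : Type*} [NormedAddCommGroup E]

lemma norm_lt_one_of_norm_eq_one_on_circle [NormedSpace ℂ E] [StrictConvexSpace ℝ E] {ψ : ℂ → E}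
    (hc : ContinuousOn ψ (closedBall 0 1)) (hd : DifferentiableOn ℂ ψ (ball 0 1))
    (hs : ∀ z, ‖z‖ = 1 → ‖ψ z‖ = 1) (hderiv : ∀ z ∈ ball (0 : ℂ) 1, deriv ψ z ≠ 0) {z : ℂ}
    (hz : ‖z‖ < 1) : ‖ψ z‖ < 1 := by
  have hcl : DiffContOnCl ℂ ψ (ball 0 1) :=
    ⟨hd, by rwa [closure_ball _ one_ne_zero]⟩
  have hle : ∀ w, ‖w‖ ≤ 1 → ‖ψ w‖ ≤ 1 := fun w hw =>
    Complex.norm_le_of_forall_mem_frontier_norm_le (isBounded_ball (x := (0 : ℂ)) (r := 1)) hcl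
      (fun w hw => (hs w (by simpa [frontier_ball] using hw)).le)
      (by simpa [closure_ball] using hw)
  refine (hle z hz.le).lt_of_ne fun h1 => ?_
  have hzb : z ∈ ball (0 : ℂ) 1 := mem_ball_zero_iff.2 hz
  have hconst := Complex.eqOn_of_isPreconnected_of_isMaxOn_norm
    (convex_ball (0 : ℂ) 1).isPreconnected isOpen_ball hd hzb
    (fun w hw => by simpa [h1] using hle w (mem_ball_zero_iff.1 hw).le)
  refine hderiv z hzb ?_
  rw [(hconst.eventuallyEq_of_mem (isOpen_ball.mem_nhds hzb)).deriv_eq]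
  exact deriv_const _ _

lemma isCompact_setOf_mem_ball_of_norm_eq_one_on_circle {ψ : ℂ → E}
    (hc : ContinuousOn ψ (closedBall 0 1)) (hs : ∀ z, ‖z‖ = 1 → ‖ψ z‖ = 1) {K : Set E}
    (hK : K ⊆ ball 0 1) (hKc : IsCompact K) : IsCompact {z ∈ ball (0 : ℂ) 1 | ψ z ∈ K} := by
  have : {z ∈ ball (0 : ℂ) 1 | ψ z ∈ K} = closedBall 0 1 ∩ ψ ⁻¹' K := by
    ext z
    refine ⟨fun ⟨h1, h2⟩ => ⟨ball_subset_closedBall h1, h2⟩, fun ⟨h1, h2⟩ => ⟨?_, h2⟩⟩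
    rw [mem_closedBall_zero_iff] at h1
    refine mem_ball_zero_iff.2 (h1.lt_of_ne fun h => ?_)
    exact (mem_ball_zero_iff.1 (hK h2)).ne (hs z h)
  rw [this]
  exact (isCompact_closedBall _ _).of_isClosed_subset
    (hc.preimage_isClosed_of_isClosed isClosed_closedBall hKc.isClosed) inter_subset_left

lemma eVariationOn_eq_top_of_lipschitzWith_comp {E' : Type*} [NormedAddCommGroup E'] {f : ℝ → E}
    {g : E → E'} {C : NNReal} (hg : LipschitzWith C g) {s : Set ℝ}
    (h : eVariationOn (fun t => g (f t)) s = ⊤) : eVariationOn f s = ⊤ := by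
  by_contra hne
  have := (hg.lipschitzOnWith (s := univ)).comp_eVariationOn_le (g := f) (mapsTo_univ _ s)
  rw [show g ∘ f = fun t => g (f t) from rfl, h] at this
  exact (ENNReal.mul_lt_top ENNReal.coe_lt_top (lt_top_iff_ne_top.2 hne)).not_ge this

end Proper

/-! ### Injective discs in higher dimension -/

section Embedding

/-- In dimension at least three the complete disc can be made injective by adding a coordinate. -/
lemma exists_complete_injective_disc (m : ℕ) :
    ∃ ψ : ℂ → EuclideanSpace ℂ (Fin (m + 3)), ContinuousOn ψ (closedBall 0 1) ∧
      DifferentiableOn ℂ ψ (ball 0 1) ∧ (∀ z, ‖z‖ = 1 → ‖ψ z‖ = 1) ∧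
      (∀ z ∈ ball (0 : ℂ) 1, deriv ψ z ≠ 0) ∧
      (∀ γ : ℝ → ℂ, DivergentPathIn (ball (0 : ℂ) 1) γ →
        eVariationOn (fun t => ψ (γ t)) (Ico 0 1) = ⊤) ∧ Function.Injective ψ := by
  obtain ⟨φ, hc, hd, hs, -, hcomplete⟩ := exists_complete_disc_fin_two
  let u : Fin (m + 3) → EuclideanSpace ℂ (Fin (m + 3)) := fun i => EuclideanSpace.single i 1
  let J : ℂ × EuclideanSpace ℂ (Fin 2) →L[ℂ] EuclideanSpace ℂ (Fin (m + 3)) :=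
    (ContinuousLinearMap.fst ℂ _ _).smulRight ((3 / 5 : ℂ) • u 0) +
      (((EuclideanSpace.proj 0).comp (ContinuousLinearMap.snd ℂ _ _)).smulRight
        ((4 / 5 : ℂ) • u 1) +
      ((EuclideanSpace.proj 1).comp (ContinuousLinearMap.snd ℂ _ _)).smulRight
        ((4 / 5 : ℂ) • u 2))
  let G : EuclideanSpace ℂ (Fin (m + 3)) →L[ℂ] EuclideanSpace ℂ (Fin 2) :=
    (EuclideanSpace.proj 1).smulRight ((5 / 4 : ℂ) • EuclideanSpace.single 0 1) +
      (EuclideanSpace.proj 2).smulRight ((5 / 4 : ℂ) • EuclideanSpace.single 1 1)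
  have hval : 2 % (m + 3) = 2 := Nat.mod_eq_of_lt (by omega)
  have h0 : ∀ p, J p 0 = 3 / 5 * p.1 := fun p => by simp [J, u, mul_comm, Fin.ext_iff, hval]
  have h1 : ∀ p, J p 1 = 4 / 5 * p.2 0 := fun p => by simp [J, u, mul_comm, Fin.ext_iff, hval]
  have h2 : ∀ p, J p 2 = 4 / 5 * p.2 1 := fun p => by simp [J, u, mul_comm, Fin.ext_iff, hval]
  have hrest : ∀ p (i : Fin m), J p i.succ.succ.succ = 0 := fun p i => by
    simp [J, u, Fin.ext_iff, show 2 % (m + 1 + 1 + 1) = 2 from hval]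
  have hGJ : ∀ p, G (J p) = p.2 := fun p => by
    ext i
    fin_cases i <;> simp [G, h1, h2] <;> ring
  have hnorm : ∀ p, ‖J p‖ ^ 2 = 9 / 25 * ‖p.1‖ ^ 2 + 16 / 25 * ‖p.2‖ ^ 2 := fun p => by
    rw [EuclideanSpace.norm_sq_eq, EuclideanSpace.norm_sq_eq, Fin.sum_univ_succ,
      Fin.sum_univ_succ, Fin.sum_univ_succ]
    simp only [hrest, Fin.sum_univ_two, h0]
    rw [show Fin.succ (0 : Fin (m + 2)) = 1 from rfl,
      show Fin.succ (Fin.succ (0 : Fin (m + 1))) = 2 from rfl, h1, h2]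
    simp only [norm_mul, norm_zero]
    norm_num
    ring
  have hdψ : DifferentiableOn ℂ (fun z => J (z, φ z)) (ball 0 1) :=
    J.differentiable.comp_differentiableOn (differentiableOn_id.prodMk hd)
  refine ⟨fun z => J (z, φ z), J.continuous.comp_continuousOn (continuousOn_id.prodMk hc), hdψ,
    fun z hz => ?_, fun z hz hz0 => ?_, fun γ hγ => ?_, fun z w hzw => ?_⟩
  · have := hnorm (z, φ z)
    rw [hz, hs z hz] at this
    norm_num at this
    rcases this with h | h
    · exact h
    · linarith [norm_nonneg (J (z, φ z))]
  · have h3 := (hdψ.differentiableAt (isOpen_ball.mem_nhds hz)).hasDerivAt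
    have h4 := (EuclideanSpace.proj (0 : Fin (m + 3)) :
      EuclideanSpace ℂ (Fin (m + 3)) →L[ℂ] ℂ).hasFDerivAt.comp_hasDerivAt z h3
    rw [hz0, map_zero] at h4
    have h5 : HasDerivAt (fun z : ℂ => 3 / 5 * z) (3 / 5 * 1) z := (hasDerivAt_id z).const_mul _
    have h6 := h4.unique (h5.congr_of_eventuallyEq (Eventually.of_forall fun w => h0 (w, φ w)))
    norm_num at h6
  · refine eVariationOn_eq_top_of_lipschitzWith_comp G.lipschitz ?_
    simpa only [hGJ] using hcomplete γ hγ
  · have h3 := congrArg (fun x => x 0) hzw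
    simpa [h0] using h3

end Embedding

end Construction

/-- There is a continuous map of the closed disc into the closed unit ball of ℂⁿ, sending the
circle into the sphere, whose restriction to the open disc is a complete proper holomorphic
immersion into 𝔹ₙ, injective when `n ≥ 3`. -/
theorem complete_proper_disc_in_ball_extending_to_boundary (n : ℕ) (hn : 2 ≤ n) :
    ∃ φ : ℂ → EuclideanSpace ℂ (Fin n),
      ContinuousOn φ (Metric.closedBall (0 : ℂ) 1) ∧
      (∀ ζ ∈ Metric.closedBall (0 : ℂ) 1,
        φ ζ ∈ Metric.closedBall (0 : EuclideanSpace ℂ (Fin n)) 1) ∧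
      (∀ ζ ∈ Metric.sphere (0 : ℂ) 1, φ ζ ∈ Metric.sphere (0 : EuclideanSpace ℂ (Fin n)) 1) ∧
      DifferentiableOn ℂ φ (Metric.ball (0 : ℂ) 1) ∧
      (∀ ζ ∈ Metric.ball (0 : ℂ) 1, deriv φ ζ ≠ 0) ∧
      (∀ ζ ∈ Metric.ball (0 : ℂ) 1, φ ζ ∈ Metric.ball (0 : EuclideanSpace ℂ (Fin n)) 1) ∧
      (∀ K : Set (EuclideanSpace ℂ (Fin n)),
        K ⊆ Metric.ball (0 : EuclideanSpace ℂ (Fin n)) 1 → IsCompact K →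
        IsCompact {ζ ∈ Metric.ball (0 : ℂ) 1 | φ ζ ∈ K}) ∧
      (∀ γ : ℝ → ℂ, DivergentPathIn (Metric.ball (0 : ℂ) 1) γ →
        eVariationOn (fun t => φ (γ t)) (Set.Ico 0 1) = ⊤) ∧
      (3 ≤ n → Set.InjOn φ (Metric.ball (0 : ℂ) 1)) := by
  obtain ⟨ψ, hc, hd, hs, hderiv, hcomplete, hinj⟩ :
      ∃ ψ : ℂ → EuclideanSpace ℂ (Fin n), ContinuousOn ψ (closedBall 0 1) ∧
        DifferentiableOn ℂ ψ (ball 0 1) ∧ (∀ z, ‖z‖ = 1 → ‖ψ z‖ = 1) ∧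
        (∀ z ∈ ball (0 : ℂ) 1, deriv ψ z ≠ 0) ∧
        (∀ γ : ℝ → ℂ, DivergentPathIn (ball (0 : ℂ) 1) γ →
          eVariationOn (fun t => ψ (γ t)) (Ico 0 1) = ⊤) ∧
        (3 ≤ n → InjOn ψ (ball 0 1)) := by
    obtain rfl | h3 := hn.eq_or_lt
    · obtain ⟨φ, hc, hd, hs, hderiv, hcomplete⟩ := exists_complete_disc_fin_two
      exact ⟨φ, hc, hd, hs, hderiv, hcomplete, fun h => absurd h (by norm_num)⟩
    · obtain ⟨m, rfl⟩ := Nat.exists_eq_add_of_le' h3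
      obtain ⟨ψ, hc, hd, hs, hderiv, hcomplete, hinj⟩ := exists_complete_injective_disc m
      exact ⟨ψ, hc, hd, hs, hderiv, hcomplete, fun _ => hinj.injOn⟩
  have hlt : ∀ z, ‖z‖ < 1 → ‖ψ z‖ < 1 := fun z hz =>
    norm_lt_one_of_norm_eq_one_on_circle hc hd hs hderiv hz
  refine ⟨ψ, hc, fun z hz => ?_, fun z hz => ?_, hd, hderiv, fun z hz => ?_,
    fun K hK hKc => isCompact_setOf_mem_ball_of_norm_eq_one_on_circle hc hs hK hKc, hcomplete,
    hinj⟩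
  · rw [mem_closedBall_zero_iff] at hz ⊢
    rcases hz.eq_or_lt with h | h
    · exact (hs z h).le
    · exact (hlt z h).le
  · rw [mem_sphere_zero_iff_norm] at hz ⊢
    exact hs z hz
  · rw [mem_ball_zero_iff] at hz ⊢
    exact hlt z hz
end
end

section
/- Let n ≥ 2 and let D ⊆ ℂⁿ be a nonempty connected open set. Then there exists a holomorphic map φ : 𝔻 → ℂⁿ which is an immersion (φ'(ζ) ≠ 0 for every ζ ∈ 𝔻), has image φ(𝔻) contained in and dense in D, and is complete: for every divergent path γ : [0,1) → 𝔻 the path φ ∘ γ has infinite length. Moreover, if n ≥ 3 then φ can in addition be chosen injective. (Disc case of the Alarcón–Castro Infantes theorem on complete densely immersed complex curves.) -/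
open Set Metric
open scoped ENNReal

noncomputable section

open Filter Topology

section Scheme

variable {E : Type*} [NormedAddCommGroup E] [NormedSpace ℂ E]

/-- `P` holds for every holomorphic map on the unit disc that is uniformly close to `F` on a
suitable smaller closed disc. -/
def StablyHolds (P : (ℂ → E) → Prop) (F : ℂ → E) : Prop :=
  ∃ r < (1 : ℝ), ∃ ε > (0 : ℝ), ∀ G : ℂ → E, DifferentiableOn ℂ G (ball 0 1) →
    (∀ z ∈ closedBall (0 : ℂ) r, ‖G z - F z‖ ≤ ε) → P G

/-- Every member of `A` can be approximated, uniformly on compact subsets of the unit disc, by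
members of `A` at which `P` holds stably. -/
def GenericIn (A : Set (ℂ → E)) (P : (ℂ → E) → Prop) : Prop :=
  ∀ F ∈ A, ∀ r < (1 : ℝ), ∀ ε > (0 : ℝ), ∃ F' ∈ A,
    (∀ z ∈ closedBall (0 : ℂ) r, ‖F' z - F z‖ ≤ ε) ∧ StablyHolds P F'

/-- The maps that are holomorphic near the closed unit disc and send it into `D`. -/
def closedDiscsIn (D : Set E) : Set (ℂ → E) :=
  {F | AnalyticOnNhd ℂ F (closedBall 0 1) ∧ MapsTo F (closedBall 0 1) D}

theorem StablyHolds.mono {P Q : (ℂ → E) → Prop} {F : ℂ → E} (h : StablyHolds P F)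
    (hPQ : ∀ G, DifferentiableOn ℂ G (ball 0 1) → P G → Q G) : StablyHolds Q F := by
  obtain ⟨r, hr, ε, hε, h⟩ := h
  exact ⟨r, hr, ε, hε, fun G hG hGF => hPQ G hG (h G hG hGF)⟩

theorem StablyHolds.and {P Q : (ℂ → E) → Prop} {F : ℂ → E} (hP : StablyHolds P F)
    (hQ : StablyHolds Q F) : StablyHolds (fun G => P G ∧ Q G) F := by
  obtain ⟨r, hr, ε, hε, h⟩ := hP
  obtain ⟨r', hr', ε', hε', h'⟩ := hQ
  refine ⟨max r r', max_lt hr hr', min ε ε', lt_min hε hε', fun G hG hGF => ⟨?_, ?_⟩⟩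
  · exact h G hG fun z hz =>
      (hGF z (closedBall_subset_closedBall (le_max_left _ _) hz)).trans (min_le_left _ _)
  · exact h' G hG fun z hz =>
      (hGF z (closedBall_subset_closedBall (le_max_right _ _) hz)).trans (min_le_right _ _)

theorem StablyHolds.exists_forall_close {P : (ℂ → E) → Prop} {F : ℂ → E} (h : StablyHolds P F) :
    ∃ r < (1 : ℝ), ∃ ε > (0 : ℝ), ∀ F' : ℂ → E,
      (∀ z ∈ closedBall (0 : ℂ) r, ‖F' z - F z‖ ≤ ε) → StablyHolds P F' := by
  obtain ⟨r, hr, ε, hε, h⟩ := h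
  refine ⟨r, hr, ε / 2, by positivity, fun F' hF' => ⟨r, hr, ε / 2, by positivity, ?_⟩⟩
  intro G hG hGF'
  refine h G hG fun z hz => ?_
  calc ‖G z - F z‖ ≤ ‖G z - F' z‖ + ‖F' z - F z‖ := norm_sub_le_norm_sub_add_norm_sub _ _ _
    _ ≤ ε := by linarith [hGF' z hz, hF' z hz]

theorem GenericIn.and {A : Set (ℂ → E)} {P Q : (ℂ → E) → Prop} (hP : GenericIn A P)
    (hQ : GenericIn A Q) : GenericIn A (fun G => P G ∧ Q G) := by
  intro F hF r hr ε hε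
  obtain ⟨F₁, hF₁, hF₁F, hPF₁⟩ := hP F hF r hr (ε / 2) (by positivity)
  obtain ⟨r₁, hr₁, ε₁, hε₁, hstab⟩ := hPF₁.exists_forall_close
  obtain ⟨F₂, hF₂, hF₂F₁, hQF₂⟩ := hQ F₁ hF₁ (max r r₁) (max_lt hr hr₁) (min (ε / 2) ε₁)
    (lt_min (by positivity) hε₁)
  refine ⟨F₂, hF₂, fun z hz => ?_, .and (hstab F₂ fun z hz => ?_) hQF₂⟩
  · have h₁ := (hF₂F₁ z (closedBall_subset_closedBall (le_max_left _ _) hz)).trans (min_le_left _ _)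
    calc ‖F₂ z - F z‖ ≤ ‖F₂ z - F₁ z‖ + ‖F₁ z - F z‖ := norm_sub_le_norm_sub_add_norm_sub _ _ _
      _ ≤ ε := by linarith [hF₁F z hz]
  · exact (hF₂F₁ z (closedBall_subset_closedBall (le_max_right _ _) hz)).trans (min_le_right _ _)

/-- A Baire category principle: countably many generic properties hold simultaneously for some
holomorphic map on the unit disc. -/
theorem exists_differentiableOn_of_genericIn [CompleteSpace E] {A : Set (ℂ → E)}
    (hne : A.Nonempty) (hA : ∀ F ∈ A, DifferentiableOn ℂ F (ball 0 1))
    {P : ℕ → (ℂ → E) → Prop} (hP : ∀ k, GenericIn A (P k)) :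
    ∃ φ : ℂ → E, DifferentiableOn ℂ φ (ball 0 1) ∧ ∀ k, P k φ := by
  let State := {s : (ℂ → E) × ℝ × ℝ // s.1 ∈ A ∧ s.2.1 < 1 ∧ 0 < s.2.2}
  have hstep : ∀ (k : ℕ) (s : State), ∃ s' : State,
      (∀ z ∈ closedBall (0 : ℂ) s.1.2.1, ‖s'.1.1 z - s.1.1 z‖ ≤ s.1.2.2 / 2) ∧
      s'.1.2.2 ≤ s.1.2.2 / 2 ∧ s.1.2.1 ≤ s'.1.2.1 ∧ 1 - 1 / ((k : ℝ) + 1) ≤ s'.1.2.1 ∧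
      ∀ G : ℂ → E, DifferentiableOn ℂ G (ball 0 1) →
        (∀ z ∈ closedBall (0 : ℂ) s'.1.2.1, ‖G z - s'.1.1 z‖ ≤ s'.1.2.2) → P k G := by
    rintro k ⟨⟨F, r, ε⟩, hF, hr, hε⟩
    obtain ⟨F', hF', hclose, r', hr', ε', hε', hstab⟩ := hP k F hF r hr (ε / 2) (half_pos hε)
    have hk : 1 - 1 / ((k : ℝ) + 1) < 1 := by
      have : (0 : ℝ) < 1 / ((k : ℝ) + 1) := by positivity
      linarith
    refine ⟨⟨⟨F', max (max r r') (1 - 1 / ((k : ℝ) + 1)), min ε' (ε / 2)⟩, hF',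
      max_lt (max_lt hr hr') hk, lt_min hε' (half_pos hε)⟩, hclose, min_le_right _ _,
      (le_max_left _ _).trans (le_max_left _ _), le_max_right _ _, fun G hG hGF => ?_⟩
    exact hstab G hG fun z hz => (hGF z (closedBall_subset_closedBall
      ((le_max_right _ _).trans (le_max_left _ _)) hz)).trans (min_le_left _ _)
  choose next hclose hhalf hmono hrad hstab using hstep
  obtain ⟨F₀, hF₀⟩ := hne
  let seq : ℕ → State := fun k => Nat.rec ⟨⟨F₀, 0, 1⟩, hF₀, by norm_num, by norm_num⟩ next k
  set F : ℕ → ℂ → E := fun k => (seq k).1.1 with hFdef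
  set r : ℕ → ℝ := fun k => (seq k).1.2.1 with hrdef
  set ε : ℕ → ℝ := fun k => (seq k).1.2.2 with hεdef
  have hrmono : Monotone r := monotone_nat_of_le_succ fun k => hmono k (seq k)
  have hεpos : ∀ k, 0 < ε k := fun k => (seq k).2.2.2
  have hεhalf : ∀ k, ε (k + 1) ≤ ε k / 2 := fun k => hhalf k (seq k)
  have hεlim : Tendsto ε atTop (𝓝 0) := by
    have hpow : ∀ k, ε k ≤ (1 / 2 : ℝ) ^ k := by
      intro k
      induction k with
      | zero => simp [hεdef, seq]
      | succ k ih => rw [pow_succ]; linarith [hεhalf k]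
    exact squeeze_zero (fun k => (hεpos k).le) hpow
      (tendsto_pow_atTop_nhds_zero_of_lt_one (by norm_num) (by norm_num))
  have hdist : ∀ k j, k ≤ j → ∀ z ∈ closedBall (0 : ℂ) (r k), ‖F j z - F k z‖ ≤ ε k - ε j := by
    intro k j hkj z hz
    induction j, hkj using Nat.le_induction with
    | base => simp
    | succ j hkj ih =>
      have h₁ := hclose j (seq j) z (closedBall_subset_closedBall (hrmono hkj) hz)
      calc ‖F (j + 1) z - F k z‖ ≤ ‖F (j + 1) z - F j z‖ + ‖F j z - F k z‖ :=
            norm_sub_le_norm_sub_add_norm_sub _ _ _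
        _ ≤ ε j / 2 + (ε k - ε j) := add_le_add h₁ ih
        _ ≤ ε k - ε (j + 1) := by linarith [hεhalf j]
  have hexh : ∀ z ∈ ball (0 : ℂ) 1, ∃ k, ‖z‖ < r k := by
    intro z hz
    rw [mem_ball_zero_iff] at hz
    obtain ⟨k, hk⟩ := exists_nat_one_div_lt (sub_pos.2 hz)
    exact ⟨k + 1, by linarith [hrad k (seq k)]⟩
  have hlim : ∀ z, ∃ l, z ∈ ball (0 : ℂ) 1 → Tendsto (fun j => F j z) atTop (𝓝 l) := by
    intro z
    by_cases hz : z ∈ ball (0 : ℂ) 1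
    · obtain ⟨k, hk⟩ := hexh z hz
      have hc : CauchySeq fun j => F j z := by
        refine Metric.cauchySeq_iff'.2 fun δ hδ => ?_
        obtain ⟨N, hN⟩ := (hεlim.eventually_lt_const hδ).exists_forall_of_atTop
        refine ⟨max N k, fun m hm => ?_⟩
        rw [dist_eq_norm]
        have := hdist (max N k) m hm z (by
          rw [mem_closedBall_zero_iff]; exact hk.le.trans (hrmono (le_max_right _ _)))
        linarith [hN _ (le_max_left N k), hεpos m]
      obtain ⟨l, hl⟩ := cauchySeq_tendsto_of_complete hc
      exact ⟨l, fun _ => hl⟩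
    · exact ⟨0, fun h => absurd h hz⟩
  choose φ hφ using hlim
  have hφclose : ∀ k, ∀ z ∈ closedBall (0 : ℂ) (r k), ‖φ z - F k z‖ ≤ ε k := by
    intro k z hz
    have hz1 : z ∈ ball (0 : ℂ) 1 := closedBall_subset_ball (seq k).2.2.1 hz
    refine le_of_tendsto ((hφ z hz1).sub_const (F k z)).norm ?_
    filter_upwards [eventually_ge_atTop k] with j hj
    linarith [hdist k j hj z hz, hεpos j]
  have hdiff : DifferentiableOn ℂ φ (ball 0 1) := by
    refine TendstoLocallyUniformlyOn.differentiableOn (φ := atTop) (F := F) ?_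
      (Eventually.of_forall fun k => hA _ (seq k).2.1) isOpen_ball
    refine Metric.tendstoLocallyUniformlyOn_iff.2 fun δ hδ z hz => ?_
    obtain ⟨k, hk⟩ := hexh z hz
    refine ⟨closedBall 0 (r k), mem_nhdsWithin_of_mem_nhds
      (closedBall_mem_nhds_of_mem (by rwa [mem_ball_zero_iff])), ?_⟩
    filter_upwards [eventually_ge_atTop k, hεlim.eventually_lt_const hδ] with j hj hεj y hy
    rw [dist_eq_norm]
    exact (hφclose j y (closedBall_subset_closedBall (hrmono hj) hy)).trans_lt hεj
  exact ⟨φ, hdiff, fun k => hstab k (seq k) φ hdiff (hφclose (k + 1))⟩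

end Scheme

section Crossing

theorem ofReal_sub_le_eVariationOn_of_locally {M : Type*} [PseudoMetricSpace M] {a b : ℝ}
    (hab : a ≤ b) {g : ℝ → M} {τ : ℝ → ℝ}
    (h : ∀ t ∈ Icc a b, ∃ U : Set ℝ, IsOpen U ∧ t ∈ U ∧
      ∀ x ∈ U ∩ Icc a b, ∀ y ∈ U ∩ Icc a b, |τ x - τ y| ≤ dist (g x) (g y)) :
    ENNReal.ofReal (τ b - τ a) ≤ eVariationOn g (Icc a b) := by
  choose! U hUo htU hU using h
  obtain ⟨t, ht0, htmono, ⟨m, hm⟩, hcov⟩ := exists_monotone_Icc_subset_open_cover_Icc hab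
    (c := fun i : Icc a b => (Subtype.val ⁻¹' U i : Set (Icc a b)))
    (fun i => (hUo i i.2).preimage continuous_subtype_val)
    (fun x _ => mem_iUnion.2 ⟨x, htU x x.2⟩)
  have key : ∀ k, ENNReal.ofReal (τ (t k) - τ a) ≤ eVariationOn g (Icc a (t k)) := by
    intro k
    induction k with
    | zero => simp [ht0]
    | succ k ih =>
      have hle : (t k : ℝ) ≤ t (k + 1) := htmono (Nat.le_succ k)
      obtain ⟨i, hi⟩ := hcov k
      have hd := hU i i.2 (t (k + 1)) ⟨hi (right_mem_Icc.2 hle), (t (k + 1)).2⟩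
        (t k) ⟨hi (left_mem_Icc.2 hle), (t k).2⟩
      have hadd := eVariationOn.Icc_add_Icc g (s := univ) (t k).2.1 hle (mem_univ _)
      simp only [univ_inter] at hadd
      calc ENNReal.ofReal (τ (t (k + 1)) - τ a)
          ≤ ENNReal.ofReal ((τ (t k) - τ a) + dist (g (t (k + 1))) (g (t k))) :=
            ENNReal.ofReal_le_ofReal (by linarith [le_abs_self (τ (t (k + 1)) - τ (t k))])
        _ ≤ ENNReal.ofReal (τ (t k) - τ a) + ENNReal.ofReal (dist (g (t (k + 1))) (g (t k))) :=
            ENNReal.ofReal_add_le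
        _ ≤ eVariationOn g (Icc a (t k)) + eVariationOn g (Icc (t k) (t (k + 1))) := by
            gcongr
            rw [← edist_dist]
            exact eVariationOn.edist_le g (right_mem_Icc.2 hle) (left_mem_Icc.2 hle)
        _ = _ := hadd
  simpa [hm m le_rfl] using key m

variable {E : Type*} [NormedAddCommGroup E]

/-- Every path in the unit disc from `{‖z‖ ≤ s}` to `{‖z‖ ≥ s'}` has a `G`-image of length at
least `l`. -/
def CrossingLengthGE (G : ℂ → E) (s s' l : ℝ) : Prop :=
  ∀ (γ : ℝ → ℂ) (a b : ℝ), a ≤ b → ContinuousOn γ (Icc a b) →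
    (∀ t ∈ Icc a b, γ t ∈ ball (0 : ℂ) 1) → ‖γ a‖ ≤ s → s' ≤ ‖γ b‖ →
    ENNReal.ofReal l ≤ eVariationOn (fun t => G (γ t)) (Icc a b)

theorem CrossingLengthGE.add {G : ℂ → E} {s₀ s s' s₁ l l' : ℝ} (h : CrossingLengthGE G s₀ s l)
    (h' : CrossingLengthGE G s' s₁ l') (hs₀ : s₀ ≤ s) (hs : s ≤ s') (hs₁ : s' ≤ s₁)
    (hl : 0 ≤ l) (hl' : 0 ≤ l') : CrossingLengthGE G s₀ s₁ (l + l') := by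
  intro γ a b hab hγ hγball ha hb
  obtain ⟨c, hc, hcs⟩ : ∃ c ∈ Icc a b, ‖γ c‖ = s :=
    intermediate_value_Icc hab hγ.norm ⟨ha.trans hs₀, hs.trans (hs₁.trans hb)⟩
  have hadd := eVariationOn.Icc_add_Icc (fun t => G (γ t)) (s := univ) hc.1 hc.2 (mem_univ _)
  simp only [univ_inter] at hadd
  rw [← hadd, ENNReal.ofReal_add hl hl']
  gcongr
  · exact h γ a c hc.1 (hγ.mono (Icc_subset_Icc_right hc.2))
      (fun t ht => hγball t (Icc_subset_Icc_right hc.2 ht)) ha hcs.ge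
  · exact h' γ c b hc.2 (hγ.mono (Icc_subset_Icc_left hc.1))
      (fun t ht => hγball t (Icc_subset_Icc_left hc.1 ht)) (hcs.le.trans hs) hb

variable [NormedSpace ℂ E]

theorem crossingLengthGE_of_lt_norm_deriv {G : ℂ → E} (hG : DifferentiableOn ℂ G (ball 0 1))
    [CompleteSpace E] {s s' m : ℝ} (hs : s ≤ s') (hm : 0 < m)
    (h : ∀ z ∈ ball (0 : ℂ) 1, s ≤ ‖z‖ → ‖z‖ ≤ s' → m < ‖deriv G z‖) :
    CrossingLengthGE G s s' (m * (s' - s)) := by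
  intro γ a b hab hγ hγball ha hb
  set σ : ℝ → ℝ := fun x => max s (min s' x) with hσ
  have hσlip : ∀ x y, |σ x - σ y| ≤ |x - y| := fun x y => by
    refine (abs_max_sub_max_le_max _ _ _ _).trans (max_le (by simp) ?_)
    exact (abs_min_sub_min_le_max _ _ _ _).trans (max_le (by simp) le_rfl)
  have hlocal : ∀ z ∈ ball (0 : ℂ) 1, ∃ V : Set ℂ, IsOpen V ∧ z ∈ V ∧
      ∀ x ∈ V, ∀ y ∈ V, |m * σ ‖x‖ - m * σ ‖y‖| ≤ dist (G x) (G y) := by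
    intro z hz
    have habs : ∀ x y : ℂ, |m * σ ‖x‖ - m * σ ‖y‖| = m * |σ ‖x‖ - σ ‖y‖| := fun x y => by
      rw [← mul_sub, abs_mul, abs_of_pos hm]
    rcases lt_or_ge ‖z‖ s with h₁ | h₁
    · refine ⟨{x | ‖x‖ < s}, isOpen_lt continuous_norm continuous_const, h₁, fun x hx y hy => ?_⟩
      have hx' : σ ‖x‖ = s := max_eq_left ((min_le_right _ _).trans (le_of_lt hx))
      have hy' : σ ‖y‖ = s := max_eq_left ((min_le_right _ _).trans (le_of_lt hy))
      rw [hx', hy', sub_self, abs_zero]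
      exact dist_nonneg
    rcases lt_or_ge s' ‖z‖ with h₂ | h₂
    · refine ⟨{x | s' < ‖x‖}, isOpen_lt continuous_const continuous_norm, h₂, fun x hx y hy => ?_⟩
      have hx' : σ ‖x‖ = max s s' := congrArg _ (min_eq_left (le_of_lt hx))
      have hy' : σ ‖y‖ = max s s' := congrArg _ (min_eq_left (le_of_lt hy))
      rw [hx', hy', sub_self, abs_zero]
      exact dist_nonneg
    have hd : HasStrictDerivAt G (deriv G z) z :=
      ((hG.analyticOnNhd isOpen_ball) z hz).hasStrictDerivAt
    have hgap : 0 < ‖deriv G z‖ - m := sub_pos.2 (h z hz h₁ h₂)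
    have hev := hd.isLittleO.def hgap
    rw [nhds_prod_eq, eventually_prod_self_iff'] at hev
    obtain ⟨W, hW, hWV⟩ := hev
    obtain ⟨V, hVW, hVo, hzV⟩ := _root_.mem_nhds_iff.1 hW
    refine ⟨V, hVo, hzV, fun x hx y hy => ?_⟩
    have hxy : ‖G x - G y - (x - y) • deriv G z‖ ≤ (‖deriv G z‖ - m) * ‖x - y‖ :=
      hWV x (hVW hx) y (hVW hy)
    rw [habs, dist_eq_norm]
    have h₃ : ‖(x - y) • deriv G z‖ ≤ ‖G x - G y‖ + ‖G x - G y - (x - y) • deriv G z‖ := by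
      simpa using norm_sub_le (G x - G y) (G x - G y - (x - y) • deriv G z)
    rw [norm_smul] at h₃
    have h₄ : |σ ‖x‖ - σ ‖y‖| ≤ ‖x - y‖ := (hσlip _ _).trans (abs_norm_sub_norm_le x y)
    nlinarith [mul_le_mul_of_nonneg_left h₄ hm.le]
  have hvar := ofReal_sub_le_eVariationOn_of_locally hab (g := fun t => G (γ t))
    (τ := fun t => m * σ ‖γ t‖) fun t ht => by
      obtain ⟨V, hVo, htV, hV⟩ := hlocal (γ t) (hγball t ht)
      obtain ⟨U, hUo, hU⟩ := _root_.continuousOn_iff'.1 hγ V hVo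
      refine ⟨U, hUo, (hU.subset ⟨htV, ht⟩).1, fun x hx y hy => hV _ ?_ _ ?_⟩
      · exact (hU.superset hx).1
      · exact (hU.superset hy).1
  have ha' : σ ‖γ a‖ = s := max_eq_left ((min_le_right _ _).trans ha)
  have hb' : σ ‖γ b‖ = s' := by rw [hσ]; simp only [min_eq_left hb, max_eq_right hs]
  simpa [ha', hb', mul_sub] using hvar

theorem norm_deriv_sub_deriv_le {F G : ℂ → E} (hF : DifferentiableOn ℂ F (ball 0 1))
    (hG : DifferentiableOn ℂ G (ball 0 1)) {r r' ε : ℝ} (hr : r < r') (hr' : r' < 1)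
    (h : ∀ z ∈ closedBall (0 : ℂ) r', ‖G z - F z‖ ≤ ε) {z : ℂ} (hz : z ∈ closedBall (0 : ℂ) r) :
    ‖deriv G z - deriv F z‖ ≤ ε / (r' - r) := by
  have hsub : closedBall z (r' - r) ⊆ closedBall 0 r' := by
    refine closedBall_subset_closedBall' ?_
    have := mem_closedBall.1 hz
    linarith
  have hsub1 : closedBall (0 : ℂ) r' ⊆ ball 0 1 := closedBall_subset_ball hr'
  have hz1 : z ∈ ball (0 : ℂ) 1 := hsub1 (closedBall_subset_closedBall hr.le hz)
  have hd : DiffContOnCl ℂ (fun z => G z - F z) (ball z (r' - r)) :=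
    DifferentiableOn.diffContOnCl_ball (hG.sub hF) (hsub.trans hsub1)
  have := Complex.norm_deriv_le_of_forall_mem_sphere_norm_le (sub_pos.2 hr) hd
    fun w hw => h w (hsub (sphere_subset_closedBall hw))
  rwa [deriv_fun_sub (hG.differentiableAt (isOpen_ball.mem_nhds hz1))
    (hF.differentiableAt (isOpen_ball.mem_nhds hz1))] at this

theorem stablyHolds_norm_deriv_sub_le {F : ℂ → E} (hF : DifferentiableOn ℂ F (ball 0 1)) {r δ : ℝ}
    (hr : r < 1) (hδ : 0 < δ) :
    StablyHolds (fun G => ∀ z ∈ closedBall (0 : ℂ) r, ‖deriv G z - deriv F z‖ ≤ δ) F := by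
  refine ⟨(r + 1) / 2, by linarith, δ * ((1 - r) / 2), mul_pos hδ (by linarith),
    fun G hG hGF z hz => ?_⟩
  refine (norm_deriv_sub_deriv_le hF hG (by linarith) (by linarith) hGF hz).trans_eq ?_
  have : (r + 1) / 2 - r = (1 - r) / 2 := by ring
  rw [this, mul_div_cancel_right₀]
  linarith

theorem stablyHolds_crossingLengthGE [CompleteSpace E] {F : ℂ → E}
    (hF : DifferentiableOn ℂ F (ball 0 1)) {s s' m : ℝ} (hs : s ≤ s') (hs' : s' < 1) (hm : 0 < m)
    (h : ∀ z ∈ ball (0 : ℂ) 1, s ≤ ‖z‖ → ‖z‖ ≤ s' → 2 * m < ‖deriv F z‖) :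
    StablyHolds (fun G => CrossingLengthGE G s s' (m * (s' - s))) F := by
  refine (stablyHolds_norm_deriv_sub_le hF hs' hm).mono fun G hG hGF => ?_
  refine crossingLengthGE_of_lt_norm_deriv hG hs hm fun z hz h₁ h₂ => ?_
  have h₃ := h z hz h₁ h₂
  have h₄ := hGF z (mem_closedBall_zero_iff.2 h₂)
  rw [norm_sub_rev] at h₄
  linarith [norm_sub_norm_le (deriv F z) (deriv G z)]

end Crossing

section Density

variable {E : Type*} [NormedAddCommGroup E] [NormedSpace ℂ E] {D : Set E}

theorem differentiableOn_of_mem_closedDiscsIn {F : ℂ → E} (hF : F ∈ closedDiscsIn D) :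
    DifferentiableOn ℂ F (ball 0 1) :=
  hF.1.differentiableOn.mono ball_subset_closedBall

theorem exists_forall_norm_sub_le_mem (hD : IsOpen D) {F : ℂ → E} (hF : F ∈ closedDiscsIn D) :
    ∃ κ > 0, ∀ z ∈ closedBall (0 : ℂ) 1, ∀ w, ‖w - F z‖ ≤ κ → w ∈ D := by
  obtain ⟨κ, hκ, hsub⟩ := ((isCompact_closedBall (0 : ℂ) 1).image_of_continuousOn
    hF.1.continuousOn).exists_cthickening_subset_open hD hF.2.image_subset
  refine ⟨κ, hκ, fun z hz w hw => hsub (mem_cthickening_of_dist_le w (F z) κ _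
    (mem_image_of_mem F hz) ?_)⟩
  rwa [dist_eq_norm]

theorem genericIn_mapsTo (hD : IsOpen D) {r : ℝ} (hr : r < 1) :
    GenericIn (closedDiscsIn D) (fun G => MapsTo G (closedBall (0 : ℂ) r) D) := by
  intro F hF s _ ε hε
  obtain ⟨κ, hκ, h⟩ := exists_forall_norm_sub_le_mem hD hF
  refine ⟨F, hF, fun z _ => by simpa using hε.le, r, hr, κ, hκ, fun G _ hGF z hz => ?_⟩
  exact h z (closedBall_subset_closedBall hr.le hz) _ (hGF z hz)

theorem norm_half_one_add_lt_one {z : ℂ} (hz : ‖z‖ ≤ 1) (hz1 : z ≠ 1) : ‖(1 + z) / 2‖ < 1 := by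
  have hsq : z.re * z.re + z.im * z.im ≤ 1 := by
    rw [← Complex.normSq_apply, Complex.normSq_eq_norm_sq]
    nlinarith [norm_nonneg z]
  have hre : z.re < 1 := by
    by_contra! h
    refine hz1 (Complex.ext ?_ ?_)
    · rw [Complex.one_re]; nlinarith [mul_self_nonneg z.im]
    · rw [Complex.one_im]; exact mul_self_eq_zero.1 (by nlinarith [mul_self_nonneg z.im])
  have h2 : ‖1 + z‖ ^ 2 < 2 ^ 2 := by
    rw [← Complex.normSq_eq_norm_sq, Complex.normSq_apply]
    simp only [Complex.add_re, Complex.one_re, Complex.add_im, Complex.one_im, zero_add]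
    nlinarith
  rw [norm_div, Complex.norm_ofNat, div_lt_one two_pos]
  exact lt_of_pow_lt_pow_left₀ 2 zero_le_two h2

/-- A disc can be modified near the boundary point `1`, where a high power of the peak function
`(1 + z) / 2` concentrates, so that it takes any nearby value there. -/
theorem exists_closedDisc_eval_one_eq (hD : IsOpen D) {F : ℂ → E} (hF : F ∈ closedDiscsIn D)
    {ρ : ℝ} (hρ : ball (F 1) ρ ⊆ D) {q : E} (hq : q ∈ ball (F 1) ρ) {r ε : ℝ} (hr : r < 1)
    (hε : 0 < ε) :
    ∃ F' ∈ closedDiscsIn D, (∀ z ∈ closedBall (0 : ℂ) r, ‖F' z - F z‖ ≤ ε) ∧ F' 1 = q := by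
  set v := q - F 1 with hv
  have hvρ : ‖v‖ < ρ := by rwa [mem_ball_iff_norm] at hq
  obtain ⟨κ, hκ, hκD⟩ := exists_forall_norm_sub_le_mem hD hF
  obtain ⟨η, hη, hFη⟩ := Metric.continuousOn_iff.1 hF.1.continuousOn 1 (by simp) (ρ - ‖v‖)
    (sub_pos.2 hvρ)
  set K : Set ℂ := closedBall 0 1 \ ball 1 (min η (1 - r)) with hK
  have hKc : IsCompact K := (isCompact_closedBall _ _).diff isOpen_ball
  obtain ⟨θ, hθ0, hθ1, hθ⟩ : ∃ θ : ℝ, 0 ≤ θ ∧ θ < 1 ∧ ∀ z ∈ K, ‖(1 + z) / 2‖ ≤ θ := by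
    rcases K.eq_empty_or_nonempty with h | h
    · exact ⟨0, le_rfl, one_pos, by simp [h]⟩
    obtain ⟨w, hw, hmax⟩ := hKc.exists_isMaxOn h
      (f := fun z : ℂ => ‖(1 + z) / 2‖) (by fun_prop)
    refine ⟨_, norm_nonneg _, norm_half_one_add_lt_one (mem_closedBall_zero_iff.1 hw.1) ?_, hmax⟩
    rintro rfl
    exact hw.2 (mem_ball_self (lt_min hη (sub_pos.2 hr)))
  obtain ⟨m, hm⟩ : ∃ m : ℕ, θ ^ m * ‖v‖ < min κ ε := by
    have := (tendsto_pow_atTop_nhds_zero_of_lt_one hθ0 hθ1).mul_const ‖v‖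
    rw [zero_mul] at this
    exact (this.eventually_lt_const (lt_min hκ hε)).exists
  have hsmall : ∀ z ∈ K, ‖((1 + z) / 2) ^ m • v‖ ≤ min κ ε := fun z hz => by
    rw [norm_smul, norm_pow]
    refine le_trans ?_ hm.le
    gcongr
    exact hθ z hz
  refine ⟨fun z => F z + ((1 + z) / 2) ^ m • v, ⟨?_, ?_⟩, fun z hz => ?_, ?_⟩
  · refine hF.1.add (AnalyticOnNhd.smul ?_ analyticOnNhd_const)
    exact ((analyticOnNhd_const.add analyticOnNhd_id).div analyticOnNhd_const (by simp)).pow m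
  · intro z hz
    by_cases hzη : z ∈ ball 1 (min η (1 - r))
    · refine hρ (mem_ball_iff_norm.2 ?_)
      have h₁ := hFη z hz (lt_of_lt_of_le hzη (min_le_left _ _))
      rw [dist_eq_norm] at h₁
      have h₂ : ‖((1 + z) / 2) ^ m • v‖ ≤ ‖v‖ := by
        rw [norm_smul, norm_pow]
        refine mul_le_of_le_one_left (norm_nonneg _) (pow_le_one₀ (norm_nonneg _) ?_)
        rw [norm_div, Complex.norm_ofNat, div_le_one two_pos]
        have := norm_add_le 1 z
        rw [norm_one] at this
        linarith [mem_closedBall_zero_iff.1 hz]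
      calc ‖F z + ((1 + z) / 2) ^ m • v - F 1‖
          = ‖(F z - F 1) + ((1 + z) / 2) ^ m • v‖ := by congr 1; abel
        _ ≤ ‖F z - F 1‖ + ‖((1 + z) / 2) ^ m • v‖ := norm_add_le _ _
        _ < ρ := by linarith
    · refine hκD z hz _ ?_
      rw [add_sub_cancel_left]
      exact (hsmall z ⟨hz, hzη⟩).trans (min_le_left _ _)
  · simp only [add_sub_cancel_left]
    refine (hsmall z ⟨closedBall_subset_closedBall hr.le hz, fun h => ?_⟩).trans (min_le_right _ _)
    have h₁ : ‖z - 1‖ < 1 - r := by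
      rw [← dist_eq_norm]; exact lt_of_lt_of_le h (min_le_right _ _)
    have h₂ := norm_sub_norm_le 1 z
    rw [norm_one, norm_sub_rev] at h₂
    linarith [mem_closedBall_zero_iff.1 hz]
  · simp [hv]

theorem exists_closedDisc_eval_one_eq_of_isPreconnected (hD : IsOpen D) (hDc : IsPreconnected D)
    {F : ℂ → E} (hF : F ∈ closedDiscsIn D) {q : E} (hq : q ∈ D) {r : ℝ} (hr : r < 1) :
    ∀ ε > 0, ∃ F' ∈ closedDiscsIn D,
      (∀ z ∈ closedBall (0 : ℂ) r, ‖F' z - F z‖ ≤ ε) ∧ F' 1 = q := by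
  set S : Set E := {q | ∀ ε > 0, ∃ F' ∈ closedDiscsIn D,
      (∀ z ∈ closedBall (0 : ℂ) r, ‖F' z - F z‖ ≤ ε) ∧ F' 1 = q} with hS
  have hSD : S ⊆ D := fun p hp => by
    obtain ⟨F', hF', -, rfl⟩ := hp 1 one_pos
    exact hF'.2 (by simp)
  have hball : ∀ p ∈ S, ∀ ρ, ball p ρ ⊆ D → ball p ρ ⊆ S := by
    intro p hp ρ hρ q hq ε hε
    obtain ⟨F₁, hF₁, hclose, rfl⟩ := hp (ε / 2) (half_pos hε)
    obtain ⟨F₂, hF₂, hclose', rfl⟩ := exists_closedDisc_eval_one_eq hD hF₁ hρ hq hr (half_pos hε)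
    refine ⟨F₂, hF₂, fun z hz => ?_, rfl⟩
    linarith [norm_sub_le_norm_sub_add_norm_sub (F₂ z) (F₁ z) (F z), hclose z hz, hclose' z hz]
  have hSo : IsOpen S := Metric.isOpen_iff.2 fun p hp => by
    obtain ⟨ρ, hρ, hsub⟩ := Metric.isOpen_iff.1 hD p (hSD hp)
    exact ⟨ρ, hρ, hball p hp ρ hsub⟩
  refine hDc.subset_of_closure_inter_subset hSo ⟨F 1, hF.2 (by simp), fun ε hε => ⟨F, hF, ?_, rfl⟩⟩
    ?_ hq
  · intro z _
    simpa using hε.le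
  · rintro p ⟨hpS, hpD⟩
    obtain ⟨ρ, hρ, hsub⟩ := Metric.isOpen_iff.1 hD p hpD
    obtain ⟨p', hp', hpp'⟩ := Metric.mem_closure_iff.1 hpS (ρ / 2) (half_pos hρ)
    refine hball p' hp' (ρ / 2) ((ball_subset_ball' ?_).trans hsub) hpp'
    rw [dist_comm]
    linarith

theorem genericIn_meets (hD : IsOpen D) (hDc : IsPreconnected D) {V : Set E} (hV : IsOpen V)
    (hVD : (V ∩ D).Nonempty) :
    GenericIn (closedDiscsIn D) (fun G => ∃ z ∈ ball (0 : ℂ) 1, G z ∈ V) := by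
  obtain ⟨q, hqV, hqD⟩ := hVD
  intro F hF r hr ε hε
  obtain ⟨F', hF', hclose, rfl⟩ :=
    exists_closedDisc_eval_one_eq_of_isPreconnected hD hDc hF hqD hr ε hε
  refine ⟨F', hF', hclose, ?_⟩
  obtain ⟨z, hz, hzV⟩ : ∃ z ∈ ball (0 : ℂ) 1, F' z ∈ V := by
    have hcl : (1 : ℂ) ∈ closure (ball (0 : ℂ) 1) := by
      rw [closure_ball _ one_ne_zero]; simp
    have hev : ∀ᶠ z in 𝓝 (1 : ℂ), F' z ∈ V :=
      (hF'.1 1 (by simp)).continuousAt.eventually_mem (hV.mem_nhds hqV)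
    obtain ⟨z, hz, hzV⟩ := mem_closure_iff_frequently.1 hcl |>.and_eventually hev |>.exists
    exact ⟨z, hz, hzV⟩
  obtain ⟨κ, hκ, hsub⟩ := Metric.isOpen_iff.1 hV _ hzV
  refine ⟨‖z‖, mem_ball_zero_iff.1 hz, κ / 2, half_pos hκ, fun G _ hGF => ⟨z, hz, hsub ?_⟩⟩
  rw [mem_ball_iff_norm]
  linarith [hGF z (by simp)]

end Density

section GeneralPosition

variable {E : Type*} [NormedAddCommGroup E] [NormedSpace ℂ E] {D : Set E}

theorem exists_small_translate_avoiding [FiniteDimensional ℝ E] {X : Type*} [MetricSpace X]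
    {f : X → E} {s : Set X} (hs : IsCompact s) {L : NNReal} (hf : LipschitzOnWith L f s)
    (hdim : dimH s < Module.finrank ℝ E) {δ : ℝ} (hδ : 0 < δ) :
    ∃ v : E, ‖v‖ ≤ δ ∧ ∃ c > 0, ∀ x ∈ s, c ≤ ‖f x + v‖ := by
  have hdense : Dense (f '' s)ᶜ := dense_compl_of_dimH_lt_finrank (hf.dimH_image_le.trans_lt hdim)
  obtain ⟨u, hu, hu0⟩ := hdense.exists_dist_lt 0 hδ
  have hopen : IsOpen (f '' s)ᶜ := (hs.image_of_continuousOn hf.continuousOn).isClosed.isOpen_compl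
  obtain ⟨c, hc, hsub⟩ := Metric.isOpen_iff.1 hopen u hu
  refine ⟨-u, ?_, c, hc, fun x hx => ?_⟩
  · rw [norm_neg, ← dist_zero_left]; exact hu0.le
  · by_contra! h
    rw [← sub_eq_add_neg, ← mem_ball_iff_norm] at h
    exact hsub h (mem_image_of_mem f hx)

theorem exists_lipschitzOnWith_deriv [CompleteSpace E] {F : ℂ → E}
    (hF : AnalyticOnNhd ℂ F (closedBall 0 1)) :
    ∃ L : NNReal, LipschitzOnWith L (deriv F) (closedBall 0 1) := by
  obtain ⟨C, hC⟩ := (isCompact_closedBall (0 : ℂ) 1).exists_bound_of_continuousOn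
    hF.deriv.deriv.continuousOn
  refine ⟨C.toNNReal, (convex_closedBall (0 : ℂ) 1).lipschitzOnWith_of_nnnorm_deriv_le (𝕜 := ℂ)
    (fun z hz => (hF.deriv z hz).differentiableAt) fun z hz => ?_⟩
  rw [← NNReal.coe_le_coe, coe_nnnorm]
  exact (hC z hz).trans (Real.le_coe_toNNReal C)

/-- The divided difference `(F w - F z) / (w - z)`, extended to the diagonal by `F'`. -/
def dividedDifference (F : ℂ → E) (x : ℂ × ℂ) : E :=
  ∫ t in (0 : ℝ)..1, deriv F (x.1 + t • (x.2 - x.1))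

theorem add_smul_sub_mem_closedBall {x : ℂ × ℂ} (hx : x ∈ closedBall (0 : ℂ) 1 ×ˢ closedBall 0 1)
    {t : ℝ} (ht : t ∈ Icc (0 : ℝ) 1) : x.1 + t • (x.2 - x.1) ∈ closedBall (0 : ℂ) 1 :=
  (convex_closedBall (0 : ℂ) 1).add_smul_sub_mem hx.1 hx.2 ht

theorem continuousOn_deriv_segment [CompleteSpace E] {F : ℂ → E}
    (hF : AnalyticOnNhd ℂ F (closedBall 0 1))
    {x : ℂ × ℂ} (hx : x ∈ closedBall (0 : ℂ) 1 ×ˢ closedBall 0 1) :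
    ContinuousOn (fun t : ℝ => deriv F (x.1 + t • (x.2 - x.1))) (Icc 0 1) :=
  hF.deriv.continuousOn.comp (by fun_prop) fun _ ht => add_smul_sub_mem_closedBall hx ht

theorem smul_dividedDifference [CompleteSpace E] {F : ℂ → E}
    (hF : AnalyticOnNhd ℂ F (closedBall 0 1))
    {z w : ℂ} (hz : z ∈ closedBall (0 : ℂ) 1) (hw : w ∈ closedBall (0 : ℂ) 1) :
    (w - z) • dividedDifference F (z, w) = F w - F z := by
  have := intervalIntegral.integral_unitInterval_deriv_eq_sub (f := F) (f' := deriv F) (z₀ := z)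
    (z₁ := w - z) (continuousOn_deriv_segment hF (x := (z, w)) ⟨hz, hw⟩)
    fun t ht => (hF _ (add_smul_sub_mem_closedBall (x := (z, w)) ⟨hz, hw⟩
      ht)).differentiableAt.hasDerivAt
  rwa [add_sub_cancel] at this

theorem exists_lipschitzOnWith_dividedDifference [CompleteSpace E] {F : ℂ → E}
    (hF : AnalyticOnNhd ℂ F (closedBall 0 1)) :
    ∃ L : NNReal, LipschitzOnWith L (dividedDifference F)
      (closedBall (0 : ℂ) 1 ×ˢ closedBall (0 : ℂ) 1) := by
  obtain ⟨L, hL⟩ := exists_lipschitzOnWith_deriv hF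
  refine ⟨L, LipschitzOnWith.of_dist_le_mul fun x hx y hy => ?_⟩
  have hintegrable : ∀ x ∈ closedBall (0 : ℂ) 1 ×ˢ closedBall (0 : ℂ) 1,
      IntervalIntegrable (fun t : ℝ => deriv F (x.1 + t • (x.2 - x.1)))
        MeasureTheory.volume 0 1 := fun x hx =>
    (continuousOn_deriv_segment hF hx).intervalIntegrable_of_Icc zero_le_one
  rw [dist_eq_norm, dividedDifference, dividedDifference,
    ← intervalIntegral.integral_sub (hintegrable x hx) (hintegrable y hy)]
  refine (intervalIntegral.norm_integral_le_of_norm_le_const (C := L * dist x y)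
    fun t ht => ?_).trans_eq (by simp)
  rw [uIoc_of_le zero_le_one] at ht
  have ht' : t ∈ Icc (0 : ℝ) 1 := Ioc_subset_Icc_self ht
  rw [← dist_eq_norm]
  refine (hL.dist_le_mul _ (add_smul_sub_mem_closedBall hx ht') _
    (add_smul_sub_mem_closedBall hy ht')).trans ?_
  gcongr
  rw [dist_eq_norm]
  have h₁ : ‖x.1 - y.1‖ ≤ dist x y := by
    rw [← dist_eq_norm, Prod.dist_eq]; exact le_max_left _ _
  have h₂ : ‖x.2 - y.2‖ ≤ dist x y := by
    rw [← dist_eq_norm, Prod.dist_eq]; exact le_max_right _ _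
  calc ‖x.1 + t • (x.2 - x.1) - (y.1 + t • (y.2 - y.1))‖
      = ‖(1 - t) • (x.1 - y.1) + t • (x.2 - y.2)‖ := by
        congr 1
        simp only [Complex.real_smul]
        push_cast
        ring
    _ ≤ (1 - t) * ‖x.1 - y.1‖ + t * ‖x.2 - y.2‖ := by
        refine (norm_add_le _ _).trans_eq ?_
        rw [norm_smul, norm_smul, Real.norm_of_nonneg (sub_nonneg.2 ht'.2),
          Real.norm_of_nonneg ht'.1]
    _ ≤ dist x y := by nlinarith [ht'.1, ht'.2]

theorem exists_add_smul_mem_closedDiscsIn (hD : IsOpen D) {F : ℂ → E} (hF : F ∈ closedDiscsIn D)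
    {ε : ℝ} (hε : 0 < ε) :
    ∃ δ > 0, ∀ v : E, ‖v‖ ≤ δ → (fun z => F z + z • v) ∈ closedDiscsIn D ∧
      ∀ z ∈ closedBall (0 : ℂ) 1, ‖(F z + z • v) - F z‖ ≤ ε := by
  obtain ⟨κ, hκ, hκD⟩ := exists_forall_norm_sub_le_mem hD hF
  have hsmall : ∀ v : E, ‖v‖ ≤ min κ ε → ∀ z ∈ closedBall (0 : ℂ) 1,
      ‖(F z + z • v) - F z‖ ≤ min κ ε := fun v hv z hz => by
    rw [add_sub_cancel_left, norm_smul]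
    exact (mul_le_of_le_one_left (norm_nonneg v) (mem_closedBall_zero_iff.1 hz)).trans hv
  refine ⟨min κ ε, lt_min hκ hε, fun v hv => ⟨⟨?_, fun z hz => ?_⟩, fun z hz => ?_⟩⟩
  · exact hF.1.add (analyticOnNhd_id.smul analyticOnNhd_const)
  · exact hκD z hz _ ((hsmall v hv z hz).trans (min_le_left _ _))
  · exact (hsmall v hv z hz).trans (min_le_right _ _)

theorem deriv_add_smul {F : ℂ → E} (v : E) {z : ℂ} (hF : DifferentiableAt ℂ F z) :
    deriv (fun z => F z + z • v) z = deriv F z + v := by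
  have := hF.hasDerivAt.add ((hasDerivAt_id z).smul_const v)
  rw [one_smul] at this
  exact this.deriv

theorem genericIn_deriv_ne_zero [FiniteDimensional ℝ E] [CompleteSpace E]
    (hE : 2 < Module.finrank ℝ E) (hD : IsOpen D) {r : ℝ} (hr : r < 1) :
    GenericIn (closedDiscsIn D) (fun G => ∀ z ∈ closedBall (0 : ℂ) r, deriv G z ≠ 0) := by
  intro F hF s hs ε hε
  obtain ⟨δ, hδ, hδF⟩ := exists_add_smul_mem_closedDiscsIn hD hF hε
  obtain ⟨L, hL⟩ := exists_lipschitzOnWith_deriv hF.1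
  have hdim : dimH (closedBall (0 : ℂ) 1) < Module.finrank ℝ E := by
    refine (dimH_mono (subset_univ _)).trans_lt ?_
    rw [Real.dimH_univ_eq_finrank, Complex.finrank_real_complex]
    exact_mod_cast hE
  obtain ⟨v, hv, c, hc, hcv⟩ :=
    exists_small_translate_avoiding (isCompact_closedBall _ _) hL hdim hδ
  obtain ⟨hF', hclose⟩ := hδF v hv
  refine ⟨_, hF', fun z hz => hclose z (closedBall_subset_closedBall hs.le hz), ?_⟩
  refine (stablyHolds_norm_deriv_sub_le (differentiableOn_of_mem_closedDiscsIn hF') hr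
    (half_pos hc)).mono fun G hG hGF z hz h0 => ?_
  have hz1 := closedBall_subset_closedBall hr.le hz
  have h := hGF z hz
  rw [h0, zero_sub, norm_neg, deriv_add_smul v (hF.1 z hz1).differentiableAt] at h
  linarith [hcv z hz1]

theorem genericIn_injOn [FiniteDimensional ℝ E] [CompleteSpace E]
    (hE : 4 < Module.finrank ℝ E) (hD : IsOpen D) {r : ℝ} (hr : r < 1) :
    GenericIn (closedDiscsIn D) (fun G => InjOn G (closedBall (0 : ℂ) r)) := by
  intro F hF s hs ε hε
  obtain ⟨δ, hδ, hδF⟩ := exists_add_smul_mem_closedDiscsIn hD hF hε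
  obtain ⟨L, hL⟩ := exists_lipschitzOnWith_dividedDifference hF.1
  have hdim : dimH (closedBall (0 : ℂ) 1 ×ˢ closedBall (0 : ℂ) 1) < Module.finrank ℝ E := by
    refine (dimH_mono (subset_univ _)).trans_lt ?_
    rw [Real.dimH_univ_eq_finrank, Module.finrank_prod, Complex.finrank_real_complex]
    exact_mod_cast hE
  obtain ⟨v, hv, c, hc, hcv⟩ := exists_small_translate_avoiding
    ((isCompact_closedBall _ _).prod (isCompact_closedBall _ _)) hL hdim hδ
  obtain ⟨hF', hclose⟩ := hδF v hv
  refine ⟨_, hF', fun z hz => hclose z (closedBall_subset_closedBall hs.le hz), ?_⟩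
  have hdF' := differentiableOn_of_mem_closedDiscsIn hF'
  refine (stablyHolds_norm_deriv_sub_le hdF' hr
    (half_pos hc)).mono fun G hG hGF z hz w hw hzw => ?_
  have hsub : closedBall (0 : ℂ) r ⊆ closedBall 0 1 := closedBall_subset_closedBall hr.le
  have hnhds : ∀ x ∈ closedBall (0 : ℂ) r, ball (0 : ℂ) 1 ∈ 𝓝 x := fun x hx =>
    isOpen_ball.mem_nhds (closedBall_subset_ball hr hx)
  have hlip := (convex_closedBall (0 : ℂ) r).norm_image_sub_le_of_norm_deriv_le (𝕜 := ℂ)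
    (f := fun z => G z - (F z + z • v)) (C := c / 2)
    (fun x hx => (hG.sub hdF').differentiableAt (hnhds x hx))
    (fun x hx => by
      rw [deriv_fun_sub (hG.differentiableAt (hnhds x hx)) (hdF'.differentiableAt (hnhds x hx))]
      exact hGF x hx) hz hw
  have hq := smul_dividedDifference hF.1 (hsub hz) (hsub hw)
  have hnorm : ‖w - z‖ * ‖dividedDifference F (z, w) + v‖ ≤ c / 2 * ‖w - z‖ := by
    rw [← norm_smul, smul_add, hq]
    refine le_trans (le_of_eq ?_) hlip
    rw [← norm_neg, hzw, sub_smul]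
    congr 1
    abel
  have hcw := hcv (z, w) ⟨hsub hz, hsub hw⟩
  by_contra hne
  have hpos : 0 < ‖w - z‖ := norm_pos_iff.2 (sub_ne_zero.2 (Ne.symm hne))
  nlinarith

end GeneralPosition

section Length

variable {E : Type*} [NormedAddCommGroup E]

theorem CrossingLengthGE.mono {G : ℂ → E} {s s₀ s' l l' : ℝ} (h : CrossingLengthGE G s s' l)
    (hs : s₀ ≤ s) (hl : l' ≤ l) : CrossingLengthGE G s₀ s' l' :=
  fun γ a b hab hγ hγball ha hb =>
    (ENNReal.ofReal_le_ofReal hl).trans (h γ a b hab hγ hγball (ha.trans hs) hb)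

section NormedSpace

variable [NormedSpace ℂ E] [CompleteSpace E]

/-- Adding a high-frequency term `a z ^ M W`, where `W` has constant norm `ρ` on the unit circle,
makes the image of every path towards the circle longer by a fixed multiple of `a ρ`. -/
theorem exists_pow_smul_crossingLengthGE {F W : ℂ → E} (hF : AnalyticOnNhd ℂ F (closedBall 0 1))
    (hW : AnalyticOnNhd ℂ W (closedBall 0 1)) {ρ a s η : ℝ} (hρ : 0 < ρ)
    (hWρ : ∀ z : ℂ, ‖z‖ = 1 → ‖W z‖ = ρ) (ha : 0 < a) (hs0 : 0 ≤ s) (hs1 : s < 1) (hη : 0 < η) :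
    ∃ M : ℕ, (∀ z ∈ closedBall (0 : ℂ) s, ‖((a : ℂ) * z ^ M) • W z‖ ≤ η) ∧
      ∃ s', s ≤ s' ∧ s' < 1 ∧ StablyHolds (fun G => CrossingLengthGE G s s' (a * ρ / 64))
        (fun z => F z + ((a : ℂ) * z ^ M) • W z) := by
  have hcpt := isCompact_closedBall (0 : ℂ) 1
  obtain ⟨C, hC⟩ := hcpt.exists_bound_of_continuousOn hW.continuousOn
  obtain ⟨B₁, hB₁⟩ := hcpt.exists_bound_of_continuousOn hF.deriv.continuousOn
  obtain ⟨B₂, hB₂⟩ := hcpt.exists_bound_of_continuousOn hW.deriv.continuousOn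
  obtain ⟨θ, hθ1, hθ⟩ : ∃ θ < (1 : ℝ), ∀ z ∈ closedBall (0 : ℂ) 1, θ < ‖z‖ → ρ / 2 < ‖W z‖ := by
    obtain ⟨K, hK, hKW⟩ : ∃ K : Set ℂ, IsCompact K ∧
        ∀ z, z ∈ K ↔ z ∈ closedBall (0 : ℂ) 1 ∧ ‖W z‖ ≤ ρ / 2 :=
      ⟨_, hcpt.of_isClosed_subset
        (hW.continuousOn.norm.preimage_isClosed_of_isClosed isClosed_closedBall
          (isClosed_Iic (a := ρ / 2))) inter_subset_left, fun z => Iff.rfl⟩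
    rcases K.eq_empty_or_nonempty with h | h
    · refine ⟨0, one_pos, fun z hz _ => ?_⟩
      by_contra! hWz
      exact (h ▸ (hKW z).2 ⟨hz, hWz⟩ : z ∈ (∅ : Set ℂ))
    · obtain ⟨w, hw, hmax⟩ := hK.exists_isMaxOn h continuous_norm.continuousOn
      have hw' := (hKW w).1 hw
      refine ⟨‖w‖, lt_of_le_of_ne (mem_closedBall_zero_iff.1 hw'.1) fun h1 => ?_,
        fun z hz hwz => ?_⟩
      · linarith [hWρ w h1, hw'.2]
      · by_contra! hWz
        exact absurd (hmax ((hKW z).2 ⟨hz, hWz⟩)) (not_le.2 hwz)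
  have hev₁ : ∀ᶠ M : ℕ in atTop, a * (s ^ M * C) < η := by
    have := ((tendsto_pow_atTop_nhds_zero_of_lt_one hs0 hs1).mul_const C).const_mul a
    rw [zero_mul, mul_zero] at this
    exact this.eventually_lt_const hη
  have hev₂ : ∀ᶠ M : ℕ in atTop, max s θ < 1 - 1 / (2 * (M : ℝ)) := by
    have hM : Tendsto (fun M : ℕ => 2 * (M : ℝ)) atTop atTop :=
      tendsto_natCast_atTop_atTop.const_mul_atTop two_pos
    have h := (tendsto_const_nhds (x := (1 : ℝ)) (f := atTop)).div_atTop hM |>.const_sub 1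
    rw [sub_zero] at h
    exact h.eventually_const_lt (max_lt hs1 hθ1)
  have hev₃ : ∀ᶠ M : ℕ in atTop, B₁ + a * B₂ < a * ρ / 8 * (M : ℝ) :=
    (tendsto_natCast_atTop_atTop.const_mul_atTop (by positivity)).eventually_gt_atTop _
  obtain ⟨M, hM₁, hM₂, hM₃, hM₀⟩ :=
    (hev₁.and (hev₂.and (hev₃.and (eventually_ge_atTop 1)))).exists
  have hMpos : (0 : ℝ) < M := by exact_mod_cast hM₀
  have hss₁ : s < 1 - 1 / (2 * (M : ℝ)) := (le_max_left _ _).trans_lt hM₂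
  have hwidth : (1 - 1 / (4 * (M : ℝ))) - (1 - 1 / (2 * M)) = 1 / (4 * M) := by
    field_simp; ring
  have hwpos : (0 : ℝ) < 1 / (4 * (M : ℝ)) := by positivity
  refine ⟨M, fun z hz => ?_, 1 - 1 / (4 * (M : ℝ)), by linarith, by linarith, ?_⟩
  · have hz' := mem_closedBall_zero_iff.1 hz
    rw [norm_smul, norm_mul, norm_pow, Complex.norm_of_nonneg ha.le, mul_assoc]
    refine le_trans ?_ hM₁.le
    gcongr
    exact hC z (closedBall_subset_closedBall hs1.le hz)
  have hd : DifferentiableOn ℂ (fun z => F z + ((a : ℂ) * z ^ M) • W z) (ball 0 1) := by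
    refine (DifferentiableOn.add hF.differentiableOn (DifferentiableOn.smul ?_
      hW.differentiableOn)).mono ball_subset_closedBall
    fun_prop
  have hstab := stablyHolds_crossingLengthGE hd (s := 1 - 1 / (2 * (M : ℝ)))
    (s' := 1 - 1 / (4 * (M : ℝ))) (m := a * ρ * M / 16) (by linarith) (by linarith)
    (by positivity) fun z hz h₁ h₂ => by
      have hz1 : z ∈ closedBall (0 : ℂ) 1 := ball_subset_closedBall hz
      have hznorm : ‖z‖ ≤ 1 := mem_closedBall_zero_iff.1 hz1
      have hderiv : HasDerivAt (fun z => F z + ((a : ℂ) * z ^ M) • W z)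
          (deriv F z + (((a : ℂ) * z ^ M) • deriv W z + ((a : ℂ) * (M * z ^ (M - 1))) • W z)) z :=
        (hF z hz1).differentiableAt.hasDerivAt.add
          (((hasDerivAt_pow M z).const_mul (a : ℂ)).smul (hW z hz1).differentiableAt.hasDerivAt)
      rw [hderiv.deriv]
      have hmain : a * (M * (1 / 2)) * (ρ / 2) ≤ ‖((a : ℂ) * (M * z ^ (M - 1))) • W z‖ := by
        rw [norm_smul, norm_mul, norm_mul, norm_pow, Complex.norm_of_nonneg ha.le,
          Complex.norm_natCast]
        have hpow : 1 / 2 ≤ ‖z‖ ^ (M - 1) := by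
          have hbern := one_add_mul_le_pow (a := -(1 / (2 * (M : ℝ)))) (by
            have : 1 / (2 * (M : ℝ)) ≤ 1 := by linarith
            linarith) M
          calc (1 / 2 : ℝ) = 1 + M * -(1 / (2 * (M : ℝ))) := by field_simp; ring
            _ ≤ (1 + -(1 / (2 * (M : ℝ)))) ^ M := hbern
            _ ≤ ‖z‖ ^ M := by
              gcongr
              · linarith
              · linarith
            _ ≤ ‖z‖ ^ (M - 1) := pow_le_pow_of_le_one (norm_nonneg z) hznorm (Nat.sub_le _ _)
        gcongr
        exact (hθ z hz1 (by linarith [le_max_right s θ])).le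
      have herr : ‖((a : ℂ) * z ^ M) • deriv W z‖ ≤ a * B₂ := by
        rw [norm_smul, norm_mul, norm_pow, Complex.norm_of_nonneg ha.le, mul_assoc]
        gcongr
        exact (mul_le_of_le_one_left (norm_nonneg _) (pow_le_one₀ (norm_nonneg z) hznorm)).trans
          (hB₂ z hz1)
      have htri : ‖((a : ℂ) * (M * z ^ (M - 1))) • W z‖ ≤ ‖deriv F z + (((a : ℂ) * z ^ M) •
          deriv W z + ((a : ℂ) * (M * z ^ (M - 1))) • W z)‖ + ‖deriv F z‖ +
          ‖((a : ℂ) * z ^ M) • deriv W z‖ := by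
        set x := deriv F z
        set y := ((a : ℂ) * z ^ M) • deriv W z
        set u := ((a : ℂ) * (M * z ^ (M - 1))) • W z
        calc ‖u‖ = ‖(x + (y + u)) - x - y‖ := by congr 1; abel
          _ ≤ ‖(x + (y + u)) - x‖ + ‖y‖ := norm_sub_le _ _
          _ ≤ _ := by gcongr; exact norm_sub_le _ _
      linarith [hB₁ z hz1]
  refine hstab.mono fun G _ hG => hG.mono hss₁.le (le_of_eq ?_)
  rw [hwidth]
  field_simp
  ring

end NormedSpace

/-- Entire functions `P`, `Q` that agree on the unit circle with `z ^ d * conj p` and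
`z ^ d * conj q`, where `(p, q)` has constant norm `√R` there. -/
structure IsReflectedPair (p q P Q : ℂ → ℂ) (R : ℝ) : Prop where
  differentiable_p : Differentiable ℂ p
  differentiable_q : Differentiable ℂ q
  differentiable_P : Differentiable ℂ P
  differentiable_Q : Differentiable ℂ Q
  exists_reflect : ∃ d : ℕ, ∀ z : ℂ, ‖z‖ = 1 →
    P z = z ^ d * starRingEnd ℂ (p z) ∧ Q z = z ^ d * starRingEnd ℂ (q z)
  norm_sq_add : ∀ z : ℂ, ‖z‖ = 1 → ‖p z‖ ^ 2 + ‖q z‖ ^ 2 = R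

namespace IsReflectedPair

theorem norm_sq_add_reflected {p q P Q : ℂ → ℂ} {R : ℝ} (h : IsReflectedPair p q P Q R) {z : ℂ}
    (hz : ‖z‖ = 1) : ‖Q z‖ ^ 2 + ‖P z‖ ^ 2 = R := by
  obtain ⟨d, hd⟩ := h.exists_reflect
  rw [(hd z hz).1, (hd z hz).2, norm_mul, norm_mul, norm_pow, hz, one_pow, one_mul, one_mul,
    RCLike.norm_conj, RCLike.norm_conj, add_comm, h.norm_sq_add z hz]

/-- One step of the Rudin–Shapiro recursion. -/
theorem step {p q P Q : ℂ → ℂ} {R : ℝ} (h : IsReflectedPair p q P Q R) (a : ℝ) (M : ℕ) :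
    IsReflectedPair (fun z => p z - a * z ^ M * Q z) (fun z => q z + a * z ^ M * P z)
      (fun z => z ^ M * P z - a * q z) (fun z => z ^ M * Q z + a * p z) (R * (1 + a ^ 2)) := by
  have hp := h.differentiable_p
  have hq := h.differentiable_q
  have hP := h.differentiable_P
  have hQ := h.differentiable_Q
  obtain ⟨d, hd⟩ := h.exists_reflect
  have hunit : ∀ z : ℂ, ‖z‖ = 1 → ∀ k : ℕ, z ^ k * starRingEnd ℂ z ^ k = 1 := fun z hz k => by
    rw [← mul_pow, Complex.mul_conj, Complex.normSq_eq_norm_sq, hz]; simp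
  refine ⟨by fun_prop, by fun_prop, by fun_prop, by fun_prop, ⟨d + M, fun z hz => ?_⟩,
    fun z hz => ?_⟩
  · rw [(hd z hz).1, (hd z hz).2]
    simp only [map_sub, map_add, map_mul, map_pow, Complex.conj_ofReal, Complex.conj_conj]
    have h1 := hunit z hz d
    have h2 := hunit z hz M
    rw [pow_add]
    constructor
    · linear_combination (a * q z * z ^ M * starRingEnd ℂ z ^ M) * h1 + a * q z * h2
    · linear_combination (-(a : ℂ) * p z * z ^ M * starRingEnd ℂ z ^ M) * h1 - a * p z * h2
  · rw [← h.norm_sq_add z hz, (hd z hz).1, (hd z hz).2]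
    apply Complex.ofReal_injective
    push_cast
    simp only [← Complex.mul_conj']
    simp only [map_sub, map_add, map_mul, map_pow, Complex.conj_ofReal, Complex.conj_conj]
    have h1 := hunit z hz d
    have h2 := hunit z hz M
    have h12 : z ^ M * starRingEnd ℂ z ^ M * (z ^ d * starRingEnd ℂ z ^ d) = 1 := by
      rw [h1, h2, one_mul]
    linear_combination ((a : ℂ) ^ 2 * (p z * starRingEnd ℂ (p z) + q z * starRingEnd ℂ (q z))) * h12

end IsReflectedPair

variable [InnerProductSpace ℂ E] {e f : E}

theorem norm_sq_smul_add_smul (he : ‖e‖ = 1) (hf : ‖f‖ = 1) (hef : inner ℂ e f = 0) (x y : ℂ) :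
    ‖x • e + y • f‖ ^ 2 = ‖x‖ ^ 2 + ‖y‖ ^ 2 := by
  have h := norm_add_sq_eq_norm_sq_add_norm_sq_of_inner_eq_zero (𝕜 := ℂ) (x • e) (y • f)
    (by rw [inner_smul_left, inner_smul_right, hef]; simp)
  rw [sq, sq, sq, h, norm_smul, norm_smul, he, hf, mul_one, mul_one]

theorem IsReflectedPair.norm_sq_smul_add_smul_le (he : ‖e‖ = 1) (hf : ‖f‖ = 1)
    (hef : inner ℂ e f = 0) {p q P Q : ℂ → ℂ} {R : ℝ} (h : IsReflectedPair p q P Q R) {z : ℂ}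
    (hz : z ∈ closedBall (0 : ℂ) 1) : ‖p z • e + q z • f‖ ^ 2 ≤ R := by
  have hp := h.differentiable_p
  have hq := h.differentiable_q
  have hd : Differentiable ℂ fun z => p z • e + q z • f := by fun_prop
  have hR : 0 ≤ R := by rw [← h.norm_sq_add 1 (by simp)]; positivity
  refine (Real.le_sqrt (norm_nonneg _) hR).1 (Complex.norm_le_of_forall_mem_frontier_norm_le
    (U := ball 0 1) isBounded_ball hd.diffContOnCl (fun w hw => ?_)
    (by rwa [closure_ball _ one_ne_zero]))
  rw [frontier_ball _ one_ne_zero, mem_sphere_zero_iff_norm] at hw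
  exact Real.le_sqrt_of_sq_le
    ((norm_sq_smul_add_smul he hf hef _ _).trans (h.norm_sq_add w hw)).le

variable [CompleteSpace E]

theorem exists_isReflectedPair_crossingLengthGE (he : ‖e‖ = 1) (hf : ‖f‖ = 1)
    (hef : inner ℂ e f = 0) {F : ℂ → E} (hF : AnalyticOnNhd ℂ F (closedBall 0 1)) {s₀ ρ a : ℝ}
    (hs₀ : 0 ≤ s₀) (hs₁ : s₀ < 1) (hρ : 0 < ρ) (ha : 0 < a) (j : ℕ) :
    ∃ p q P Q : ℂ → ℂ, IsReflectedPair p q P Q (ρ ^ 2 * (1 + a ^ 2) ^ j) ∧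
      ∃ s, s₀ ≤ s ∧ s < 1 ∧ StablyHolds (fun G => CrossingLengthGE G s₀ s (j * (a * ρ / 64)))
        (fun z => F z + (p z • e + q z • f)) := by
  induction j with
  | zero =>
    refine ⟨fun _ => ρ, fun _ => 0, fun _ => ρ, fun _ => 0, ⟨by fun_prop, by fun_prop,
      by fun_prop, by fun_prop, ⟨0, fun z _ => by simp⟩, fun z _ => by simp⟩, s₀, le_rfl, hs₁,
      0, one_pos, 1, one_pos, fun G _ _ γ x y _ _ _ _ _ => by simp⟩
  | succ j ih =>
    obtain ⟨p, q, P, Q, hpq, s, hs₀s, hs1, hstab⟩ := ih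
    obtain ⟨r, hr, ε, hε, hclose⟩ := hstab.exists_forall_close
    have hp := hpq.differentiable_p
    have hq := hpq.differentiable_q
    have hP := hpq.differentiable_P
    have hQ := hpq.differentiable_Q
    have hent : ∀ {g h : ℂ → ℂ}, Differentiable ℂ g → Differentiable ℂ h →
        AnalyticOnNhd ℂ (fun z => g z • e + h z • f) (closedBall 0 1) := fun {g h} hg hh z _ =>
      ((hg.analyticAt z).smul analyticAt_const).add ((hh.analyticAt z).smul analyticAt_const)
    set R := ρ ^ 2 * (1 + a ^ 2) ^ j with hR
    have hρR : ρ ≤ √R := by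
      refine Real.le_sqrt_of_sq_le (le_mul_of_one_le_right (sq_nonneg ρ) (one_le_pow₀ ?_))
      linarith [sq_nonneg a]
    obtain ⟨M, hsmall, s', hss', hs'1, hstab'⟩ := exists_pow_smul_crossingLengthGE
      (F := fun z => F z + (p z • e + q z • f)) (W := fun z => -Q z • e + P z • f)
      (ρ := √R) (a := a) (s := max s r) (η := ε) (hF.add (hent hp hq)) (hent hQ.neg hP)
      (hρ.trans_le hρR) (fun z hz => by
        rw [← hpq.norm_sq_add_reflected hz, ← norm_neg (Q z), ← norm_sq_smul_add_smul he hf hef,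
          Real.sqrt_sq (norm_nonneg _)])
      ha (hs₀.trans (hs₀s.trans (le_max_left _ _))) (max_lt hs1 hr) hε
    have heq : (fun z => F z + (p z • e + q z • f) + ((a : ℂ) * z ^ M) • (-Q z • e + P z • f)) =
        fun z => F z + ((p z - a * z ^ M * Q z) • e + (q z + a * z ^ M * P z) • f) := by
      funext z
      module
    rw [heq] at hstab'
    refine ⟨_, _, _, _, pow_succ (1 + a ^ 2) j ▸ mul_assoc (ρ ^ 2) _ _ ▸ hpq.step a M, s',
      hs₀s.trans ((le_max_left _ _).trans hss'), hs'1,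
      ((hclose _ fun z hz => ?_).and hstab').mono fun G _ hG => ?_⟩
    · refine le_trans (le_of_eq ?_)
        (hsmall z (closedBall_subset_closedBall (le_max_right _ _) hz))
      congr 1
      module
    · have h := hG.1.add hG.2 hs₀s (le_max_left _ _) hss' (by positivity) (by positivity)
      refine h.mono le_rfl ?_
      push_cast
      have : a * ρ / 64 ≤ a * √R / 64 := by gcongr
      linarith

theorem genericIn_crossingLengthGE (he : ‖e‖ = 1) (hf : ‖f‖ = 1) (hef : inner ℂ e f = 0)
    {D : Set E} (hD : IsOpen D) {r : ℝ} (hr : r < 1) (l : ℝ) :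
    GenericIn (closedDiscsIn D) fun G => ∃ s < 1, CrossingLengthGE G r s l := by
  intro F hF r₁ hr₁ ε hε
  obtain ⟨κ, hκ, hκD⟩ := exists_forall_norm_sub_le_mem hD hF
  set δ := min κ ε
  have hδ : 0 < δ := lt_min hκ hε
  obtain ⟨k, hk⟩ := exists_nat_gt (max 0 (l / (δ / 2 / 64)))
  have hk0 : (0 : ℝ) < k := (le_max_left _ _).trans_lt hk
  have hkl : l < k * (δ / 2 / 64) :=
    (div_lt_iff₀ (by positivity)).1 ((le_max_right _ _).trans_lt hk)
  obtain ⟨p, q, P, Q, hpq, s, -, hs1, hstab⟩ := exists_isReflectedPair_crossingLengthGE he hf hef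
    hF.1 (s₀ := max r 0) (ρ := δ / 2) (a := 1 / k) (le_max_right _ _) (max_lt hr one_pos)
    (by positivity) (by positivity) (k ^ 2)
  have hbound : ∀ z ∈ closedBall (0 : ℂ) 1, ‖p z • e + q z • f‖ ≤ δ := fun z hz => by
    refine (sq_le_sq₀ (norm_nonneg _) hδ.le).1
      ((hpq.norm_sq_smul_add_smul_le he hf hef hz).trans ?_)
    have hexp : (1 + (1 / (k : ℝ)) ^ 2) ^ k ^ 2 ≤ 4 :=
      calc (1 + (1 / (k : ℝ)) ^ 2) ^ k ^ 2 ≤ Real.exp ((1 / (k : ℝ)) ^ 2) ^ k ^ 2 := by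
            gcongr
            linarith [Real.add_one_le_exp ((1 / (k : ℝ)) ^ 2)]
        _ = Real.exp 1 := by
            rw [← Real.exp_nat_mul]
            congr 1
            push_cast
            field_simp
        _ ≤ 4 := by linarith [Real.exp_one_lt_d9]
    nlinarith [sq_nonneg δ]
  have hp := hpq.differentiable_p
  have hq := hpq.differentiable_q
  refine ⟨fun z => F z + (p z • e + q z • f), ⟨hF.1.add fun z _ =>
    ((hp.analyticAt z).smul analyticAt_const).add ((hq.analyticAt z).smul analyticAt_const),
    fun z hz => hκD z hz _ ?_⟩, fun z hz => ?_, hstab.mono fun G _ hG => ⟨s, hs1, ?_⟩⟩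
  · rw [add_sub_cancel_left]
    exact (hbound z hz).trans (min_le_left _ _)
  · rw [add_sub_cancel_left]
    exact (hbound z (closedBall_subset_closedBall hr₁.le hz)).trans (min_le_right _ _)
  · refine hG.mono (le_max_left _ _) (hkl.le.trans (le_of_eq ?_))
    push_cast
    field_simp

end Length

section Main

theorem GenericIn.of_forall {E : Type*} [NormedAddCommGroup E] [NormedSpace ℂ E]
    {A : Set (ℂ → E)} {P : (ℂ → E) → Prop} (h : ∀ G, P G) : GenericIn A P :=
  fun F hF _ _ _ hε => ⟨F, hF, fun z _ => by simpa using hε.le,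
    0, one_pos, 1, one_pos, fun G _ _ => h G⟩

theorem eVariationOn_eq_top_of_crossingLengthGE {E : Type*} [NormedAddCommGroup E] {φ : ℂ → E}
    (hφ : ∀ k : ℕ, ∃ s < 1, CrossingLengthGE φ (1 - 1 / ((k : ℝ) + 1)) s k) {γ : ℝ → ℂ}
    (hγ : DivergentPathIn (ball (0 : ℂ) 1) γ) :
    eVariationOn (fun t => φ (γ t)) (Ico 0 1) = ⊤ := by
  obtain ⟨hcont, hball, hdiv⟩ := hγ
  refine ENNReal.eq_top_of_forall_nnreal_le fun N => ?_
  have h0 : ‖γ 0‖ < 1 := mem_ball_zero_iff.1 (hball 0 ⟨le_rfl, one_pos⟩)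
  have hev : ∀ᶠ k : ℕ in atTop, ‖γ 0‖ < 1 - 1 / ((k : ℝ) + 1) := by
    have h := (tendsto_one_div_add_atTop_nhds_zero_nat (𝕜 := ℝ)).const_sub 1
    rw [sub_zero] at h
    exact h.eventually_const_lt h0
  obtain ⟨k, hk, hkN⟩ :=
    (hev.and (tendsto_natCast_atTop_atTop.eventually_ge_atTop (N : ℝ))).exists
  obtain ⟨s, hs, hlen⟩ := hφ k
  obtain ⟨t, ht, hout⟩ := hdiv (closedBall 0 s) (closedBall_subset_ball hs)
    (isCompact_closedBall 0 s)
  have hsub : Icc 0 t ⊆ Ico 0 1 := Icc_subset_Ico_right ht.2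
  have hs' : s ≤ ‖γ t‖ := by
    by_contra! h
    exact hout t ⟨le_rfl, ht.2⟩ (mem_closedBall_zero_iff.2 h.le)
  calc (N : ℝ≥0∞) = ENNReal.ofReal N := (ENNReal.ofReal_coe_nnreal).symm
    _ ≤ ENNReal.ofReal k := ENNReal.ofReal_le_ofReal hkN
    _ ≤ eVariationOn (fun t => φ (γ t)) (Icc 0 t) :=
      hlen γ 0 t ht.1 (hcont.mono hsub) (fun u hu => hball u (hsub hu)) hk.le hs'
    _ ≤ _ := eVariationOn.mono _ hsub

theorem exists_nat_mem_closedBall_one_sub {z : ℂ} (hz : z ∈ ball (0 : ℂ) 1) :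
    ∃ k : ℕ, ∀ m ≥ k, z ∈ closedBall (0 : ℂ) (1 - 1 / ((m : ℝ) + 1)) := by
  have h := (tendsto_one_div_add_atTop_nhds_zero_nat (𝕜 := ℝ)).const_sub 1
  rw [sub_zero] at h
  obtain ⟨k, hk⟩ := eventually_atTop.1 (h.eventually_const_lt (mem_ball_zero_iff.1 hz))
  exact ⟨k, fun m hm => mem_closedBall_zero_iff.2 (hk m hm).le⟩

end Main

/-- Disc case of the Alarcón–Castro Infantes theorem: every nonempty connected open domain
`D ⊆ ℂⁿ` (`n ≥ 2`) admits a complete holomorphic immersed disc with dense image in `D`,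
injective when `n ≥ 3`. -/
theorem complete_dense_disc_in_domain (n : ℕ) (hn : 2 ≤ n)
    (D : Set (EuclideanSpace ℂ (Fin n))) (hDo : IsOpen D) (hDconn : IsConnected D) :
    ∃ φ : ℂ → EuclideanSpace ℂ (Fin n),
      DifferentiableOn ℂ φ (Metric.ball (0 : ℂ) 1) ∧
      (∀ ζ ∈ Metric.ball (0 : ℂ) 1, deriv φ ζ ≠ 0) ∧
      (∀ ζ ∈ Metric.ball (0 : ℂ) 1, φ ζ ∈ D) ∧
      D ⊆ closure (φ '' Metric.ball (0 : ℂ) 1) ∧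
      (∀ γ : ℝ → ℂ, DivergentPathIn (Metric.ball (0 : ℂ) 1) γ →
        eVariationOn (fun t => φ (γ t)) (Set.Ico 0 1) = ⊤) ∧
      (3 ≤ n → Set.InjOn φ (Metric.ball (0 : ℂ) 1)) := by
  have hfin : Module.finrank ℝ (EuclideanSpace ℂ (Fin n)) = 2 * n := by
    rw [finrank_real_of_complex, finrank_euclideanSpace, Fintype.card_fin]
  have : FiniteDimensional ℝ (EuclideanSpace ℂ (Fin n)) := FiniteDimensional.complexToReal _
  obtain ⟨x₀, hx₀⟩ := hDconn.nonempty
  obtain ⟨U₀, hU₀, -, -⟩ :=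
    (TopologicalSpace.isBasis_countableBasis _).exists_subset_of_mem_open hx₀ hDo
  obtain ⟨V, hV⟩ := (TopologicalSpace.countable_countableBasis
    (EuclideanSpace ℂ (Fin n))).exists_eq_range ⟨U₀, hU₀⟩
  have hVo : ∀ k, IsOpen (V k) := fun k =>
    TopologicalSpace.isOpen_of_mem_countableBasis (hV ▸ mem_range_self k)
  have hr : ∀ k : ℕ, 1 - 1 / ((k : ℝ) + 1) < 1 := fun k => sub_lt_self _ (by positivity)
  let i₀ : Fin n := ⟨0, by omega⟩
  let i₁ : Fin n := ⟨1, by omega⟩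
  obtain ⟨φ, hφ, hP⟩ := exists_differentiableOn_of_genericIn (A := closedDiscsIn D)
    ⟨fun _ => x₀, fun _ _ => analyticAt_const, fun _ _ => hx₀⟩
    (fun F hF => differentiableOn_of_mem_closedDiscsIn hF) fun k : ℕ =>
    ((((genericIn_mapsTo hDo (hr k)).and (genericIn_deriv_ne_zero (by omega) hDo (hr k))).and
      (genericIn_crossingLengthGE (e := EuclideanSpace.single i₀ 1)
        (f := EuclideanSpace.single i₁ 1) (by simp) (by simp)
        (by simp [i₀, i₁, EuclideanSpace.inner_single_left]) hDo (hr k) k)).and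
      (show GenericIn (closedDiscsIn D)
          (fun G => (V k ∩ D).Nonempty → ∃ z ∈ ball (0 : ℂ) 1, G z ∈ V k) by
        by_cases h : (V k ∩ D).Nonempty
        · simpa only [h, true_imp_iff] using
            genericIn_meets hDo hDconn.isPreconnected (hVo k) h
        · exact .of_forall fun G h' => absurd h' h)).and
      (show GenericIn (closedDiscsIn D)
          (fun G => 3 ≤ n → InjOn G (closedBall 0 (1 - 1 / ((k : ℝ) + 1)))) by
        by_cases h : 3 ≤ n
        · simpa only [h, true_imp_iff] using genericIn_injOn (by omega) hDo (hr k)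
        · exact .of_forall fun G h' => absurd h' h)
  refine ⟨φ, hφ, fun z hz => ?_, fun z hz => ?_, fun x hx => ?_, fun γ hγ => ?_,
    fun h3 z hz w hw hzw => ?_⟩
  · obtain ⟨k, hk⟩ := exists_nat_mem_closedBall_one_sub hz
    exact (hP k).1.1.1.2 z (hk k le_rfl)
  · obtain ⟨k, hk⟩ := exists_nat_mem_closedBall_one_sub hz
    exact (hP k).1.1.1.1 (hk k le_rfl)
  · refine (TopologicalSpace.isBasis_countableBasis _).mem_closure_iff.2 fun U hU hxU => ?_
    obtain ⟨k, rfl⟩ : U ∈ range V := hV ▸ hU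
    obtain ⟨z, hz, hzV⟩ := (hP k).1.2 ⟨x, hxU, hx⟩
    exact ⟨φ z, hzV, mem_image_of_mem φ hz⟩
  · exact eVariationOn_eq_top_of_crossingLengthGE (fun k => (hP k).1.1.2) hγ
  · obtain ⟨k, hk⟩ := exists_nat_mem_closedBall_one_sub hz
    obtain ⟨m, hm⟩ := exists_nat_mem_closedBall_one_sub hw
    exact (hP (max k m)).2 h3 (hk _ (le_max_left _ _)) (hm _ (le_max_right _ _)) hzw
end
end
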